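/- Let [R₁](h,t) = (1/2π_p)∫₀^{2π_p} R₁(h,t,θ) dθ. Then there exist a constant δ₁ ∈ (0, 1/10) and constants C' > 0, h₀ such that |D_h^i D_t^j [R₁](h,t)| ≤ C' · (h^{-i} + h^{-δ₁ - i/q}) for all 0 ≤ i+j ≤ 21, all t, and all h ≥ h₀. -/

import Mathlib

/-- The one-dimensional `p`-Laplacian nonlinearity `φ_p(s) = |s|^{p-2} s`. -/
noncomputable def phi (p s : ℝ) : ℝ := |s| ^ (p - 2) * s

/-- The `p`-analogue of `π`: `π_p = 2π (p-1)^{1/p} / (p sin(π/p))`. -/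
noncomputable def pip (p : ℝ) : ℝ :=
  2 * Real.pi * (p - 1) ^ (1 / p) / (p * Real.sin (Real.pi / p))

/-- Mixed partial derivative `D_x^i D_t^j F(x,t)` of a function of two real variables. -/
noncomputable def iterD (F : ℝ → ℝ → ℝ) (i j : ℕ) (x t : ℝ) : ℝ :=
  iteratedDeriv i (fun y => iteratedDeriv j (F y) t) x

/-- `g (θ, h, t)` is jointly continuous for `h > h₀` and bounded there by `W h`. -/
def BoundedBeyond (h₀ : ℝ) (W : ℝ → ℝ) (g : ℝ → ℝ → ℝ → ℝ) : Prop :=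
  ContinuousOn (fun z : ℝ × ℝ × ℝ => g z.1 z.2.1 z.2.2) {z | h₀ < z.2.1} ∧
    ∀ θ h t, h₀ < h → |g θ h t| ≤ W h

/-- All `(h, t)`-derivatives of `g` up to order `m` exist and are continuous for `h > h₀`, and a
derivative with `i` factors `∂_h` is bounded by `h ^ (-s * i) * W h`. -/
def WeightedBound (s h₀ : ℝ) : ℕ → (ℝ → ℝ) → (ℝ → ℝ → ℝ → ℝ) → Prop
  | 0, W, g => BoundedBeyond h₀ W g
  | m + 1, W, g => BoundedBeyond h₀ W g ∧ ∃ gh gt : ℝ → ℝ → ℝ → ℝ,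
      (∀ θ h t, h₀ < h → HasDerivAt (fun x => g θ x t) (gh θ h t) h ∧
        HasDerivAt (fun τ => g θ h τ) (gt θ h t) t) ∧
      WeightedBound s h₀ m (fun h => h ^ (-s) * W h) gh ∧ WeightedBound s h₀ m W gt

/-- Symbols of order `α`: `WeightedBound` with weight a multiple of `h ^ α`. -/
def IsSymbol (s h₀ : ℝ) (m : ℕ) (α : ℝ) (g : ℝ → ℝ → ℝ → ℝ) : Prop :=
  ∃ K, WeightedBound s h₀ m (fun h => K * h ^ α) g

theorem isOpen_beyond (h₀ : ℝ) : IsOpen {z : ℝ × ℝ × ℝ | h₀ < z.2.1} :=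
  isOpen_lt continuous_const (by fun_prop)

theorem WeightedBound.base {s h₀ : ℝ} {m : ℕ} {W : ℝ → ℝ} {g : ℝ → ℝ → ℝ → ℝ}
    (hg : WeightedBound s h₀ m W g) : BoundedBeyond h₀ W g := by
  cases m with
  | zero => exact hg
  | succ m => exact hg.1

theorem BoundedBeyond.congr {h₀ : ℝ} {W₁ W₂ : ℝ → ℝ} {g₁ g₂ : ℝ → ℝ → ℝ → ℝ}
    (hg : BoundedBeyond h₀ W₁ g₁) (hW : ∀ h, h₀ < h → W₁ h ≤ W₂ h)
    (h12 : ∀ θ h t, h₀ < h → g₂ θ h t = g₁ θ h t) : BoundedBeyond h₀ W₂ g₂ := by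
  refine ⟨hg.1.congr fun z hz => h12 _ _ _ hz, fun θ h t hh => ?_⟩
  rw [h12 θ h t hh]
  exact (hg.2 θ h t hh).trans (hW h hh)

theorem WeightedBound.congr {s h₀ : ℝ} (hh₀ : 0 ≤ h₀) {m : ℕ} {W₁ W₂ : ℝ → ℝ}
    {g₁ g₂ : ℝ → ℝ → ℝ → ℝ} (hg : WeightedBound s h₀ m W₁ g₁)
    (hW : ∀ h, h₀ < h → W₁ h ≤ W₂ h) (h12 : ∀ θ h t, h₀ < h → g₂ θ h t = g₁ θ h t) :
    WeightedBound s h₀ m W₂ g₂ := by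
  induction m generalizing W₁ W₂ g₁ g₂ with
  | zero => exact BoundedBeyond.congr hg hW h12
  | succ m ih =>
    obtain ⟨hb, gh, gt, hd, hgh, hgt⟩ := hg
    refine ⟨hb.congr hW h12, gh, gt, fun θ h t hh => ⟨?_, ?_⟩, ih hgh ?_ fun _ _ _ _ => rfl,
      ih hgt hW fun _ _ _ _ => rfl⟩
    · refine (hd θ h t hh).1.congr_of_eventuallyEq ?_
      filter_upwards [lt_mem_nhds hh] with x hx using h12 θ x t hx
    · refine (hd θ h t hh).2.congr_of_eventuallyEq ?_
      filter_upwards with x using h12 θ h x hh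
    · intro h hh
      exact mul_le_mul_of_nonneg_left (hW h hh) (Real.rpow_nonneg (hh₀.trans hh.le) _)

theorem WeightedBound.of_succ {s h₀ : ℝ} {m : ℕ} {W : ℝ → ℝ} {g : ℝ → ℝ → ℝ → ℝ}
    (hg : WeightedBound s h₀ (m + 1) W g) : WeightedBound s h₀ m W g := by
  induction m generalizing W g with
  | zero => exact hg.1
  | succ m ih =>
    obtain ⟨hb, gh, gt, hd, hgh, hgt⟩ := hg
    exact ⟨hb, gh, gt, hd, ih hgh, ih hgt⟩

theorem WeightedBound.add {s h₀ : ℝ} (hh₀ : 0 ≤ h₀) {m : ℕ} {W₁ W₂ : ℝ → ℝ}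
    {g₁ g₂ : ℝ → ℝ → ℝ → ℝ} (hg₁ : WeightedBound s h₀ m W₁ g₁)
    (hg₂ : WeightedBound s h₀ m W₂ g₂) :
    WeightedBound s h₀ m (fun h => W₁ h + W₂ h) (fun θ h t => g₁ θ h t + g₂ θ h t) := by
  induction m generalizing W₁ W₂ g₁ g₂ with
  | zero =>
    exact ⟨hg₁.1.add hg₂.1, fun θ h t hh =>
      (abs_add_le _ _).trans (add_le_add (hg₁.2 θ h t hh) (hg₂.2 θ h t hh))⟩
  | succ m ih =>
    obtain ⟨hb₁, gh₁, gt₁, hd₁, hgh₁, hgt₁⟩ := hg₁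
    obtain ⟨hb₂, gh₂, gt₂, hd₂, hgh₂, hgt₂⟩ := hg₂
    refine ⟨⟨hb₁.1.add hb₂.1, fun θ h t hh =>
      (abs_add_le _ _).trans (add_le_add (hb₁.2 θ h t hh) (hb₂.2 θ h t hh))⟩, _, _,
      fun θ h t hh => ⟨(hd₁ θ h t hh).1.add (hd₂ θ h t hh).1,
        (hd₁ θ h t hh).2.add (hd₂ θ h t hh).2⟩, ?_, ih hgt₁ hgt₂⟩
    exact (ih hgh₁ hgh₂).congr hh₀ (fun h _ => (mul_add _ _ _).ge) fun _ _ _ _ => rfl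

theorem IsSymbol.congr {s h₀ : ℝ} (hh₀ : 0 ≤ h₀) {m : ℕ} {α : ℝ} {g₁ g₂ : ℝ → ℝ → ℝ → ℝ}
    (hg : IsSymbol s h₀ m α g₁) (h12 : ∀ θ h t, h₀ < h → g₂ θ h t = g₁ θ h t) :
    IsSymbol s h₀ m α g₂ := by
  obtain ⟨K, hK⟩ := hg
  exact ⟨K, hK.congr hh₀ (fun _ _ => le_rfl) h12⟩

theorem IsSymbol.of_succ {s h₀ : ℝ} {m : ℕ} {α : ℝ} {g : ℝ → ℝ → ℝ → ℝ}
    (hg : IsSymbol s h₀ (m + 1) α g) : IsSymbol s h₀ m α g :=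
  let ⟨K, hK⟩ := hg
  ⟨K, hK.of_succ⟩

theorem IsSymbol.of_le {s h₀ : ℝ} {m n : ℕ} (hmn : n ≤ m) {α : ℝ} {g : ℝ → ℝ → ℝ → ℝ}
    (hg : IsSymbol s h₀ m α g) : IsSymbol s h₀ n α g := by
  induction m, hmn using Nat.le_induction with
  | base => exact hg
  | succ m _ ih => exact ih hg.of_succ

theorem IsSymbol.continuousOn {s h₀ : ℝ} {m : ℕ} {α : ℝ} {g : ℝ → ℝ → ℝ → ℝ}
    (hg : IsSymbol s h₀ m α g) :
    ContinuousOn (fun z : ℝ × ℝ × ℝ => g z.1 z.2.1 z.2.2) {z | h₀ < z.2.1} :=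
  let ⟨_, hK⟩ := hg
  hK.base.1

theorem IsSymbol.exists_pos {s h₀ : ℝ} (hh₀ : 0 ≤ h₀) {m : ℕ} {α : ℝ} {g : ℝ → ℝ → ℝ → ℝ}
    (hg : IsSymbol s h₀ m α g) :
    ∃ K, 0 < K ∧ WeightedBound s h₀ m (fun h => K * h ^ α) g := by
  obtain ⟨K, hK⟩ := hg
  refine ⟨max K 1, by positivity, hK.congr hh₀ (fun h hh => ?_) fun _ _ _ _ => rfl⟩
  exact mul_le_mul_of_nonneg_right (le_max_left _ _) (Real.rpow_nonneg (hh₀.trans hh.le) _)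

theorem IsSymbol.mono {s h₀ : ℝ} (hh₀ : 1 ≤ h₀) {m : ℕ} {α β : ℝ} (hαβ : α ≤ β)
    {g : ℝ → ℝ → ℝ → ℝ} (hg : IsSymbol s h₀ m α g) : IsSymbol s h₀ m β g := by
  obtain ⟨K, hK0, hK⟩ := hg.exists_pos (zero_le_one.trans hh₀)
  refine ⟨K, hK.congr (zero_le_one.trans hh₀) (fun h hh => ?_) fun _ _ _ _ => rfl⟩
  exact mul_le_mul_of_nonneg_left
    (Real.rpow_le_rpow_of_exponent_le (hh₀.trans hh.le) hαβ) hK0.le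

theorem IsSymbol.succ_intro {s h₀ : ℝ} (hh₀ : 0 ≤ h₀) {m : ℕ} {α : ℝ}
    {g gh gt : ℝ → ℝ → ℝ → ℝ} (hg : IsSymbol s h₀ 0 α g)
    (hdh : ∀ θ h t, h₀ < h → HasDerivAt (fun x => g θ x t) (gh θ h t) h)
    (hdt : ∀ θ h t, h₀ < h → HasDerivAt (fun τ => g θ h τ) (gt θ h t) t)
    (hgh : IsSymbol s h₀ m (α - s) gh) (hgt : IsSymbol s h₀ m α gt) :
    IsSymbol s h₀ (m + 1) α g := by
  obtain ⟨K₁, hK₁⟩ := hg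
  obtain ⟨K₂, hK₂⟩ := hgh
  obtain ⟨K₃, hK₃⟩ := hgt
  refine ⟨max K₁ (max K₂ K₃), BoundedBeyond.congr hK₁ (fun h hh => ?_) fun _ _ _ _ => rfl, gh, gt,
    fun θ h t hh => ⟨hdh θ h t hh, hdt θ h t hh⟩,
    hK₂.congr hh₀ (fun h hh => ?_) fun _ _ _ _ => rfl,
    hK₃.congr hh₀ (fun h hh => ?_) fun _ _ _ _ => rfl⟩
  · exact mul_le_mul_of_nonneg_right (le_max_left _ _) (Real.rpow_nonneg (hh₀.trans hh.le) _)
  · have h0 : 0 < h := hh₀.trans_lt hh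
    have h1 : h ^ (-s) * (max K₁ (max K₂ K₃) * h ^ α) = max K₁ (max K₂ K₃) * h ^ (α - s) := by
      rw [sub_eq_add_neg, Real.rpow_add h0]; ring
    simp only [h1]
    exact mul_le_mul_of_nonneg_right ((le_max_left _ _).trans (le_max_right _ _))
      (Real.rpow_nonneg h0.le _)
  · exact mul_le_mul_of_nonneg_right ((le_max_right _ _).trans (le_max_right _ _))
      (Real.rpow_nonneg (hh₀.trans hh.le) _)

theorem IsSymbol.succ_elim {s h₀ : ℝ} (hh₀ : 0 ≤ h₀) {m : ℕ} {α : ℝ} {g : ℝ → ℝ → ℝ → ℝ}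
    (hg : IsSymbol s h₀ (m + 1) α g) : ∃ gh gt : ℝ → ℝ → ℝ → ℝ,
      (∀ θ h t, h₀ < h → HasDerivAt (fun x => g θ x t) (gh θ h t) h) ∧
      (∀ θ h t, h₀ < h → HasDerivAt (fun τ => g θ h τ) (gt θ h t) t) ∧
      IsSymbol s h₀ m (α - s) gh ∧ IsSymbol s h₀ m α gt := by
  obtain ⟨K, hb, gh, gt, hd, hgh, hgt⟩ := hg
  refine ⟨gh, gt, fun θ h t hh => (hd θ h t hh).1, fun θ h t hh => (hd θ h t hh).2,
    ⟨K, hgh.congr hh₀ (fun h hh => ?_) fun _ _ _ _ => rfl⟩, ⟨K, hgt⟩⟩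
  rw [sub_eq_add_neg, Real.rpow_add (hh₀.trans_lt hh)]
  exact le_of_eq (by ring)

theorem IsSymbol.add {s h₀ : ℝ} (hh₀ : 0 ≤ h₀) {m : ℕ} {α : ℝ} {g₁ g₂ : ℝ → ℝ → ℝ → ℝ}
    (hg₁ : IsSymbol s h₀ m α g₁) (hg₂ : IsSymbol s h₀ m α g₂) :
    IsSymbol s h₀ m α (fun θ h t => g₁ θ h t + g₂ θ h t) := by
  obtain ⟨K₁, hK₁⟩ := hg₁
  obtain ⟨K₂, hK₂⟩ := hg₂
  exact ⟨K₁ + K₂, (hK₁.add hh₀ hK₂).congr hh₀ (fun h _ => (add_mul _ _ _).ge) fun _ _ _ _ => rfl⟩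

theorem IsSymbol.mul_order_zero {s h₀ : ℝ} (hh₀ : 0 ≤ h₀) {α β : ℝ} {g₁ g₂ : ℝ → ℝ → ℝ → ℝ}
    (hg₁ : IsSymbol s h₀ 0 α g₁) (hg₂ : IsSymbol s h₀ 0 β g₂) :
    IsSymbol s h₀ 0 (α + β) (fun θ h t => g₁ θ h t * g₂ θ h t) := by
  obtain ⟨K₁, hc₁, hb₁⟩ := hg₁
  obtain ⟨K₂, hc₂, hb₂⟩ := hg₂
  refine ⟨K₁ * K₂, hc₁.mul hc₂, fun θ h t hh => ?_⟩
  have h1 : |g₁ θ h t| ≤ K₁ * h ^ α := hb₁ θ h t hh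
  have h2 : |g₂ θ h t| ≤ K₂ * h ^ β := hb₂ θ h t hh
  change _ ≤ K₁ * K₂ * h ^ (α + β)
  rw [abs_mul, Real.rpow_add (hh₀.trans_lt hh)]
  calc _ ≤ (K₁ * h ^ α) * (K₂ * h ^ β) :=
        mul_le_mul h1 h2 (abs_nonneg _) ((abs_nonneg _).trans h1)
    _ = _ := by ring

theorem IsSymbol.mul {s h₀ : ℝ} (hh₀ : 0 ≤ h₀) {m : ℕ} {α β γ : ℝ}
    {g₁ g₂ : ℝ → ℝ → ℝ → ℝ} (hg₁ : IsSymbol s h₀ m α g₁) (hg₂ : IsSymbol s h₀ m β g₂)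
    (hγ : α + β = γ) : IsSymbol s h₀ m γ (fun θ h t => g₁ θ h t * g₂ θ h t) := by
  subst hγ
  induction m generalizing α β g₁ g₂ with
  | zero => exact hg₁.mul_order_zero hh₀ hg₂
  | succ m ih =>
    obtain ⟨gh₁, gt₁, hdh₁, hdt₁, hgh₁, hgt₁⟩ := hg₁.succ_elim hh₀
    obtain ⟨gh₂, gt₂, hdh₂, hdt₂, hgh₂, hgt₂⟩ := hg₂.succ_elim hh₀
    refine IsSymbol.succ_intro hh₀
      (gh := fun θ h t => gh₁ θ h t * g₂ θ h t + g₁ θ h t * gh₂ θ h t)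
      (gt := fun θ h t => gt₁ θ h t * g₂ θ h t + g₁ θ h t * gt₂ θ h t)
      ((hg₁.of_le (Nat.zero_le _)).mul_order_zero hh₀ (hg₂.of_le (Nat.zero_le _)))
      (fun θ h t hh => (hdh₁ θ h t hh).mul (hdh₂ θ h t hh))
      (fun θ h t hh => (hdt₁ θ h t hh).mul (hdt₂ θ h t hh)) ?_ ?_
    · have e₁ := ih hgh₁ hg₂.of_succ
      have e₂ := ih hg₁.of_succ hgh₂
      rw [show α - s + β = α + β - s by ring] at e₁
      rw [show α + (β - s) = α + β - s by ring] at e₂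
      exact e₁.add hh₀ e₂
    · exact (ih hgt₁ hg₂.of_succ).add hh₀ (ih hg₁.of_succ hgt₂)

theorem IsSymbol.zero {s h₀ : ℝ} (hh₀ : 0 ≤ h₀) (m : ℕ) (α : ℝ) :
    IsSymbol s h₀ m α (fun _ _ _ => 0) := by
  induction m generalizing α with
  | zero => exact ⟨0, continuousOn_const, fun θ h t _ => by simp⟩
  | succ m ih =>
    exact IsSymbol.succ_intro hh₀ ⟨0, continuousOn_const, fun θ h t _ => by simp⟩
      (fun _ _ _ _ => hasDerivAt_const _ _) (fun _ _ _ _ => hasDerivAt_const _ _) (ih _) (ih _)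

theorem IsSymbol.of_index {s h₀ : ℝ} (hh₀ : 0 ≤ h₀) {c : ℝ → ℝ} (hc : Continuous c) {K : ℝ}
    (hK : ∀ θ, |c θ| ≤ K) (m : ℕ) : IsSymbol s h₀ m 0 (fun θ _ _ => c θ) := by
  have base : ∀ {c : ℝ → ℝ} {K : ℝ}, Continuous c → (∀ θ, |c θ| ≤ K) →
      IsSymbol s h₀ 0 0 (fun θ _ _ => c θ) := fun {c K} hc hK =>
    ⟨K, (hc.comp continuous_fst).continuousOn, fun θ h t _ => by simpa using hK θ⟩
  cases m with
  | zero => exact base hc hK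
  | succ m =>
    exact IsSymbol.succ_intro hh₀ (base hc hK) (fun _ _ _ _ => hasDerivAt_const _ _)
      (fun _ _ _ _ => hasDerivAt_const _ _) (IsSymbol.zero hh₀ _ _) (IsSymbol.zero hh₀ _ _)

theorem IsSymbol.const {s h₀ : ℝ} (hh₀ : 0 ≤ h₀) (c : ℝ) (m : ℕ) :
    IsSymbol s h₀ m 0 (fun _ _ _ => c) :=
  IsSymbol.of_index hh₀ continuous_const (fun _ => le_rfl) m

theorem IsSymbol.const_mul {s h₀ : ℝ} (hh₀ : 0 ≤ h₀) (c : ℝ) {m : ℕ} {α : ℝ}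
    {g : ℝ → ℝ → ℝ → ℝ} (hg : IsSymbol s h₀ m α g) :
    IsSymbol s h₀ m α (fun θ h t => c * g θ h t) :=
  (IsSymbol.const hh₀ c m).mul hh₀ hg (zero_add α)

theorem IsSymbol.sub {s h₀ : ℝ} (hh₀ : 0 ≤ h₀) {m : ℕ} {α : ℝ} {g₁ g₂ : ℝ → ℝ → ℝ → ℝ}
    (hg₁ : IsSymbol s h₀ m α g₁) (hg₂ : IsSymbol s h₀ m α g₂) :
    IsSymbol s h₀ m α (fun θ h t => g₁ θ h t - g₂ θ h t) :=
  (hg₁.add hh₀ (hg₂.const_mul hh₀ (-1))).congr hh₀ fun _ _ _ _ => by ring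

/-- Powers of `h` are symbols. -/
theorem IsSymbol.rpow_self {s h₀ : ℝ} (hs : s ≤ 1) (hh₀ : 1 ≤ h₀) (m : ℕ) (β : ℝ) :
    IsSymbol s h₀ m β (fun _ h _ => h ^ β) := by
  have hh₀' : 0 ≤ h₀ := zero_le_one.trans hh₀
  have base : ∀ β : ℝ, IsSymbol s h₀ 0 β (fun _ h _ => h ^ β) := by
    refine fun β => ⟨1, ?_, fun θ h t hh => ?_⟩
    · refine ContinuousOn.rpow_const (by fun_prop) fun z hz => Or.inl ?_
      exact (hh₀'.trans_lt hz).ne'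
    · change |h ^ β| ≤ 1 * h ^ β
      rw [one_mul, abs_of_nonneg (Real.rpow_nonneg (hh₀'.trans hh.le) _)]
  induction m generalizing β with
  | zero => exact base β
  | succ m ih =>
    refine IsSymbol.succ_intro hh₀' (gh := fun _ h _ => β * h ^ (β - 1)) (gt := fun _ _ _ => 0)
      (base β) (fun θ h t hh => ?_) (fun _ _ _ _ => hasDerivAt_const _ _) ?_ ?_
    · exact Real.hasDerivAt_rpow_const (Or.inl (hh₀'.trans_lt hh).ne')
    · exact ((ih (β - 1)).const_mul hh₀' β).mono hh₀ (by linarith)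
    · exact ((ih β).const_mul hh₀' 0).congr hh₀' fun _ _ _ _ => (zero_mul _).symm

/-- A function of `t` with bounded derivatives is a symbol of order `0`. -/
theorem IsSymbol.of_time {s h₀ : ℝ} (hh₀ : 0 ≤ h₀) {F : ℕ → ℝ → ℝ} {n : ℕ}
    (hd : ∀ k, k < n → ∀ t, HasDerivAt (F k) (F (k + 1) t) t)
    (hc : ∀ k, k ≤ n → Continuous (F k)) (hb : ∀ k, k ≤ n → ∃ K, ∀ t, |F k t| ≤ K)
    {m k : ℕ} (hmk : m + k ≤ n) : IsSymbol s h₀ m 0 (fun _ _ t => F k t) := by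
  have base : ∀ k, k ≤ n → IsSymbol s h₀ 0 0 (fun _ _ t => F k t) := by
    intro k hk
    obtain ⟨K, hK⟩ := hb k hk
    have := hc k hk
    exact ⟨K, by fun_prop, fun θ h t _ => by simpa using hK t⟩
  induction m generalizing k with
  | zero => exact base k (by omega)
  | succ m ih =>
    exact IsSymbol.succ_intro hh₀ (gh := fun _ _ _ => 0) (gt := fun _ _ t => F (k + 1) t)
      (base k (by omega)) (fun _ _ _ _ => hasDerivAt_const _ _)
      (fun _ _ t _ => hd k (by omega) t)
      (IsSymbol.zero hh₀ m (0 - s)) (ih (by omega))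

theorem rpow_le_of_mem_Icc {y : ℝ} (hy : y ∈ Set.Icc (1 / 2 : ℝ) (3 / 2)) (β : ℝ) :
    y ^ β ≤ (1 / 2 : ℝ) ^ β + (3 / 2 : ℝ) ^ β := by
  have h1 : 0 ≤ (1 / 2 : ℝ) ^ β := by positivity
  have h2 : 0 ≤ (3 / 2 : ℝ) ^ β := by positivity
  rcases le_total 0 β with hβ | hβ
  · have := Real.rpow_le_rpow (by linarith [hy.1]) hy.2 hβ
    linarith
  · have := Real.rpow_le_rpow_of_nonpos (by norm_num) hy.1 hβ
    linarith

theorem abs_rpow_sub_one_le {y : ℝ} (hy : y ∈ Set.Icc (1 / 2 : ℝ) (3 / 2)) (β : ℝ) :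
    |y ^ β - 1| ≤ |β| * ((1 / 2 : ℝ) ^ (β - 1) + (3 / 2 : ℝ) ^ (β - 1)) * |y - 1| := by
  have := Convex.norm_image_sub_le_of_norm_hasDerivWithin_le (f := fun x : ℝ => x ^ β)
    (f' := fun x => β * x ^ (β - 1)) (s := Set.Icc (1 / 2 : ℝ) (3 / 2)) (x := 1) (y := y)
    (C := |β| * ((1 / 2 : ℝ) ^ (β - 1) + (3 / 2 : ℝ) ^ (β - 1)))
    (fun x hx => (Real.hasDerivAt_rpow_const
      (Or.inl (by linarith [hx.1] : 0 < x).ne')).hasDerivWithinAt)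
    (fun x hx => ?_) (convex_Icc _ _) (by norm_num) hy
  · simpa using this
  · rw [norm_mul, Real.norm_eq_abs, Real.norm_eq_abs,
      abs_of_nonneg (Real.rpow_nonneg (by linarith [hx.1]) _)]
    exact mul_le_mul_of_nonneg_left (rpow_le_of_mem_Icc hx _) (abs_nonneg _)

theorem IsSymbol.rpow {s h₀ : ℝ} (hh₀ : 0 ≤ h₀) {m : ℕ} {y : ℝ → ℝ → ℝ → ℝ}
    (hy : IsSymbol s h₀ m 0 y)
    (hmem : ∀ θ h t, h₀ < h → y θ h t ∈ Set.Icc (1 / 2 : ℝ) (3 / 2)) (β : ℝ) :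
    IsSymbol s h₀ m 0 (fun θ h t => y θ h t ^ β) := by
  have base : ∀ β : ℝ, IsSymbol s h₀ 0 0 (fun θ h t => y θ h t ^ β) := by
    refine fun β => ⟨(1 / 2 : ℝ) ^ β + (3 / 2 : ℝ) ^ β, ?_, fun θ h t hh => ?_⟩
    · exact hy.continuousOn.rpow_const fun z hz =>
        Or.inl (by linarith [(hmem z.1 z.2.1 z.2.2 hz).1] : 0 < y z.1 z.2.1 z.2.2).ne'
    · have := hmem θ h t hh
      rw [abs_of_nonneg (Real.rpow_nonneg (by linarith [this.1]) _)]
      simpa using rpow_le_of_mem_Icc this β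
  induction m generalizing β with
  | zero => exact base β
  | succ m ih =>
    obtain ⟨yh, yt, hdh, hdt, hyh, hyt⟩ := hy.succ_elim hh₀
    have hne : ∀ θ h t, h₀ < h → y θ h t ≠ 0 := fun θ h t hh =>
      (by linarith [(hmem θ h t hh).1] : 0 < y θ h t).ne'
    exact IsSymbol.succ_intro hh₀ (base β)
      (fun θ h t hh => (hdh θ h t hh).rpow_const (Or.inl (hne θ h t hh)))
      (fun θ h t hh => (hdt θ h t hh).rpow_const (Or.inl (hne θ h t hh)))
      ((hyh.mul hh₀ (IsSymbol.const hh₀ β m) (add_zero _)).mul hh₀ (ih hy.of_succ (β - 1))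
        (add_zero _))
      ((hyt.mul hh₀ (IsSymbol.const hh₀ β m) (add_zero _)).mul hh₀ (ih hy.of_succ (β - 1))
        (add_zero _))

theorem IsSymbol.rpow_sub_one {s h₀ : ℝ} (hh₀ : 0 ≤ h₀) {m : ℕ} {α : ℝ}
    {y : ℝ → ℝ → ℝ → ℝ} (hy : IsSymbol s h₀ m 0 y)
    (hy1 : IsSymbol s h₀ m α (fun θ h t => y θ h t - 1))
    (hmem : ∀ θ h t, h₀ < h → y θ h t ∈ Set.Icc (1 / 2 : ℝ) (3 / 2)) (β : ℝ) :
    IsSymbol s h₀ m α (fun θ h t => y θ h t ^ β - 1) := by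
  have hne : ∀ θ h t, h₀ < h → y θ h t ≠ 0 := fun θ h t hh =>
    (by linarith [(hmem θ h t hh).1] : 0 < y θ h t).ne'
  have base : IsSymbol s h₀ 0 α (fun θ h t => y θ h t ^ β - 1) := by
    obtain ⟨K, hK⟩ := hy1
    refine ⟨|β| * ((1 / 2 : ℝ) ^ (β - 1) + (3 / 2 : ℝ) ^ (β - 1)) * K, ?_, fun θ h t hh => ?_⟩
    · exact (hy.continuousOn.rpow_const fun z hz => Or.inl (hne _ _ _ hz)).sub continuousOn_const
    · refine (abs_rpow_sub_one_le (hmem θ h t hh) β).trans ?_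
      have := hK.base.2 θ h t hh
      simp only at this
      calc _ ≤ |β| * ((1 / 2 : ℝ) ^ (β - 1) + (3 / 2 : ℝ) ^ (β - 1)) * (K * h ^ α) :=
            mul_le_mul_of_nonneg_left this (by positivity)
        _ = _ := by ring
  cases m with
  | zero => exact base
  | succ m =>
    obtain ⟨yh, yt, hdh, hdt, hyh, hyt⟩ := hy1.succ_elim hh₀
    refine IsSymbol.succ_intro hh₀ base
      (fun θ h t hh => ?_) (fun θ h t hh => ?_)
      (gh := fun θ h t => yh θ h t * β * y θ h t ^ (β - 1))
      (gt := fun θ h t => yt θ h t * β * y θ h t ^ (β - 1)) ?_ ?_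
    · have h1 : HasDerivAt (fun x => y θ x t) (yh θ h t) h := by
        simpa using (hdh θ h t hh).add_const 1
      exact (h1.rpow_const (Or.inl (hne θ h t hh))).sub_const 1
    · have h1 : HasDerivAt (fun x => y θ h x) (yt θ h t) t := by
        simpa using (hdt θ h t hh).add_const 1
      exact (h1.rpow_const (Or.inl (hne θ h t hh))).sub_const 1
    · exact (hyh.mul hh₀ (IsSymbol.const hh₀ β m) (add_zero _)).mul hh₀
        (hy.of_succ.rpow hh₀ hmem (β - 1)) (add_zero _)
    · exact (hyt.mul hh₀ (IsSymbol.const hh₀ β m) (add_zero _)).mul hh₀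
        (hy.of_succ.rpow hh₀ hmem (β - 1)) (add_zero _)

theorem BoundedBeyond.continuous_index {h₀ : ℝ} {W : ℝ → ℝ} {g : ℝ → ℝ → ℝ → ℝ}
    (hg : BoundedBeyond h₀ W g) {h : ℝ} (hh : h₀ < h) (t : ℝ) :
    Continuous (fun θ => g θ h t) := by
  have h1 : Continuous (fun θ : ℝ => ((θ, h, t) : ℝ × ℝ × ℝ)) := by fun_prop
  exact hg.1.comp_continuous h1 fun _ => hh

theorem BoundedBeyond.continuousAt {h₀ : ℝ} {W : ℝ → ℝ} {g : ℝ → ℝ → ℝ → ℝ}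
    (hg : BoundedBeyond h₀ W g) {h : ℝ} (hh : h₀ < h) (θ t : ℝ) :
    ContinuousAt (fun z : ℝ × ℝ × ℝ => g z.1 z.2.1 z.2.2) (θ, h, t) :=
  hg.1.continuousAt ((isOpen_beyond h₀).mem_nhds hh)

theorem BoundedBeyond.integral {h₀ : ℝ} {W : ℝ → ℝ} (hW : ContinuousOn W (Set.Ioi h₀))
    {g : ℝ → ℝ → ℝ → ℝ} (hg : BoundedBeyond h₀ W g) {χ : ℝ → ℝ} (hχ : Continuous χ) {T A : ℝ}
    (hT : 0 ≤ T) (hA : ∫ θ in (0 : ℝ)..T, |χ θ| ≤ A) :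
    BoundedBeyond h₀ (fun h => A * W h) (fun _ h t => ∫ θ in (0 : ℝ)..T, χ θ * g θ h t) := by
  constructor
  · refine fun z hz => ContinuousAt.continuousWithinAt ?_
    have hz' : h₀ < z.2.1 := hz
    have hopen : {z : ℝ × ℝ × ℝ | h₀ < z.2.1} ∈ nhds z := (isOpen_beyond h₀).mem_nhds hz
    have hWz : ∀ᶠ x : ℝ × ℝ × ℝ in nhds z, W x.2.1 < W z.2.1 + 1 := by
      have h1 : ContinuousAt W z.2.1 := hW.continuousAt (Ioi_mem_nhds hz')
      have h2 : ContinuousAt (fun x : ℝ × ℝ × ℝ => W x.2.1) z :=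
        ContinuousAt.comp (f := fun x : ℝ × ℝ × ℝ => x.2.1) h1 (by fun_prop)
      exact h2.eventually_lt continuousAt_const (by linarith)
    refine intervalIntegral.continuousAt_of_dominated_interval
      (bound := fun θ => |χ θ| * (W z.2.1 + 1)) ?_ ?_ ?_ ?_
    · filter_upwards [hopen] with x hx
      exact (hχ.mul (hg.continuous_index hx x.2.2)).aestronglyMeasurable
    · filter_upwards [hopen, hWz] with x hx hx2
      refine Filter.Eventually.of_forall fun θ _ => ?_
      rw [norm_mul, Real.norm_eq_abs, Real.norm_eq_abs]
      exact mul_le_mul_of_nonneg_left ((hg.2 θ x.2.1 x.2.2 hx).trans hx2.le) (abs_nonneg _)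
    · exact Continuous.intervalIntegrable (by fun_prop) _ _
    · refine Filter.Eventually.of_forall fun θ _ => continuousAt_const.mul ?_
      have h1 := hg.continuousAt hz θ z.2.2
      exact ContinuousAt.comp (f := fun x : ℝ × ℝ × ℝ => (θ, x.2.1, x.2.2)) h1 (by fun_prop)
  · intro _ h t hh
    have hW0 : 0 ≤ W h := (abs_nonneg _).trans (hg.2 0 h t hh)
    have hcont := hg.continuous_index hh t
    calc |∫ θ in (0 : ℝ)..T, χ θ * g θ h t| ≤ ∫ θ in (0 : ℝ)..T, |χ θ * g θ h t| :=
          intervalIntegral.abs_integral_le_integral_abs hT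
      _ ≤ ∫ θ in (0 : ℝ)..T, |χ θ| * W h := by
          refine intervalIntegral.integral_mono_on hT
            (Continuous.intervalIntegrable (by fun_prop) _ _)
            (Continuous.intervalIntegrable (by fun_prop) _ _) fun θ _ => ?_
          rw [abs_mul]
          exact mul_le_mul_of_nonneg_left (hg.2 θ h t hh) (abs_nonneg _)
      _ ≤ A * W h := by
          rw [intervalIntegral.integral_mul_const]
          exact mul_le_mul_of_nonneg_right hA hW0

theorem hasDerivAt_integral_mul {h₀ : ℝ} {W V : ℝ → ℝ} (hV : ContinuousOn V (Set.Ioi h₀))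
    {g gh : ℝ → ℝ → ℝ → ℝ} (hg : BoundedBeyond h₀ W g) (hgh : BoundedBeyond h₀ V gh)
    (hd : ∀ θ h t, h₀ < h → HasDerivAt (fun x => g θ x t) (gh θ h t) h)
    {χ : ℝ → ℝ} (hχ : Continuous χ) (T : ℝ) {h : ℝ} (hh : h₀ < h) (t : ℝ) :
    HasDerivAt (fun x => ∫ θ in (0 : ℝ)..T, χ θ * g θ x t)
      (∫ θ in (0 : ℝ)..T, χ θ * gh θ h t) h := by
  have h1 : ContinuousAt V h := hV.continuousAt (Ioi_mem_nhds hh)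
  have h2 : ∀ᶠ x in nhds h, h₀ < x ∧ V x < V h + 1 :=
    (lt_mem_nhds hh).and (h1.eventually_lt continuousAt_const (by linarith))
  refine (intervalIntegral.hasDerivAt_integral_of_dominated_loc_of_deriv_le
    (s := {x | h₀ < x ∧ V x < V h + 1}) (bound := fun θ => |χ θ| * (V h + 1))
    (F := fun x θ => χ θ * g θ x t) (F' := fun x θ => χ θ * gh θ x t) h2 ?_ ?_ ?_ ?_ ?_ ?_).2
  · filter_upwards [h2] with x hx
    exact (hχ.mul (hg.continuous_index hx.1 t)).aestronglyMeasurable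
  · exact (hχ.mul (hg.continuous_index hh t)).intervalIntegrable _ _
  · exact (hχ.mul (hgh.continuous_index hh t)).aestronglyMeasurable
  · refine Filter.Eventually.of_forall fun θ _ x hx => ?_
    rw [norm_mul, Real.norm_eq_abs, Real.norm_eq_abs]
    exact mul_le_mul_of_nonneg_left ((hgh.2 θ x t hx.1).trans hx.2.le) (abs_nonneg _)
  · exact Continuous.intervalIntegrable (by fun_prop) _ _
  · exact Filter.Eventually.of_forall fun θ _ x hx => (hd θ x t hx.1).const_mul _

theorem hasDerivAt_integral_mul_time {h₀ : ℝ} {W V : ℝ → ℝ}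
    {g gt : ℝ → ℝ → ℝ → ℝ} (hg : BoundedBeyond h₀ W g) (hgt : BoundedBeyond h₀ V gt)
    (hd : ∀ θ h t, h₀ < h → HasDerivAt (fun τ => g θ h τ) (gt θ h t) t)
    {χ : ℝ → ℝ} (hχ : Continuous χ) (T : ℝ) {h : ℝ} (hh : h₀ < h) (t : ℝ) :
    HasDerivAt (fun τ => ∫ θ in (0 : ℝ)..T, χ θ * g θ h τ)
      (∫ θ in (0 : ℝ)..T, χ θ * gt θ h t) t := by
  refine (intervalIntegral.hasDerivAt_integral_of_dominated_loc_of_deriv_le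
    (s := Set.univ) (bound := fun θ => |χ θ| * V h)
    (F := fun x θ => χ θ * g θ h x) (F' := fun x θ => χ θ * gt θ h x) Filter.univ_mem
    ?_ ?_ ?_ ?_ ?_ ?_).2
  · exact Filter.Eventually.of_forall fun x =>
      (hχ.mul (hg.continuous_index hh x)).aestronglyMeasurable
  · exact (hχ.mul (hg.continuous_index hh t)).intervalIntegrable _ _
  · exact (hχ.mul (hgt.continuous_index hh t)).aestronglyMeasurable
  · refine Filter.Eventually.of_forall fun θ _ x _ => ?_
    rw [norm_mul, Real.norm_eq_abs, Real.norm_eq_abs]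
    exact mul_le_mul_of_nonneg_left (hgt.2 θ h x hh) (abs_nonneg _)
  · exact Continuous.intervalIntegrable (by fun_prop) _ _
  · exact Filter.Eventually.of_forall fun θ _ x _ => (hd θ h x hh).const_mul _

theorem continuousOn_rpow_mul {s h₀ : ℝ} (hh₀ : 0 ≤ h₀) {W : ℝ → ℝ}
    (hW : ContinuousOn W (Set.Ioi h₀)) :
    ContinuousOn (fun h => h ^ (-s) * W h) (Set.Ioi h₀) :=
  ContinuousOn.mul (continuousOn_id.rpow_const fun _ hx => Or.inl (hh₀.trans_lt hx).ne') hW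

theorem WeightedBound.integral {s h₀ : ℝ} (hh₀ : 0 ≤ h₀) {m : ℕ} {W : ℝ → ℝ}
    (hW : ContinuousOn W (Set.Ioi h₀)) {g : ℝ → ℝ → ℝ → ℝ} (hg : WeightedBound s h₀ m W g)
    {χ : ℝ → ℝ} (hχ : Continuous χ) {T A : ℝ} (hT : 0 ≤ T)
    (hA : ∫ θ in (0 : ℝ)..T, |χ θ| ≤ A) :
    WeightedBound s h₀ m (fun h => A * W h)
      (fun _ h t => ∫ θ in (0 : ℝ)..T, χ θ * g θ h t) := by
  induction m generalizing W g with
  | zero => exact BoundedBeyond.integral hW hg hχ hT hA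
  | succ m ih =>
    obtain ⟨hb, gh, gt, hd, hgh, hgt⟩ := hg
    have hV := continuousOn_rpow_mul (s := s) hh₀ hW
    refine ⟨hb.integral hW hχ hT hA, fun _ h t => ∫ θ in (0 : ℝ)..T, χ θ * gh θ h t,
      fun _ h t => ∫ θ in (0 : ℝ)..T, χ θ * gt θ h t, fun _ h t hh => ⟨?_, ?_⟩,
      (ih hV hgh).congr hh₀ (fun h _ => le_of_eq (by ring)) fun _ _ _ _ => rfl, ih hW hgt⟩
    · exact hasDerivAt_integral_mul hV hb hgh.base (fun θ h t hh => (hd θ h t hh).1) hχ T hh t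
    · exact hasDerivAt_integral_mul_time hb hgt.base (fun θ h t hh => (hd θ h t hh).2) hχ T hh t

theorem WeightedBound.eval_index {s h₀ : ℝ} (hh₀ : 0 ≤ h₀) {m : ℕ} {W : ℝ → ℝ}
    {g : ℝ → ℝ → ℝ → ℝ} (hg : WeightedBound s h₀ m W g) (c θ₀ : ℝ) :
    WeightedBound s h₀ m (fun h => |c| * W h) (fun _ h t => c * g θ₀ h t) := by
  have base : ∀ {W : ℝ → ℝ} {g : ℝ → ℝ → ℝ → ℝ}, BoundedBeyond h₀ W g →
      BoundedBeyond h₀ (fun h => |c| * W h) (fun _ h t => c * g θ₀ h t) := by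
    refine fun {W g} hg => ⟨?_, fun _ h t hh => ?_⟩
    · have h1 : ContinuousOn (fun z : ℝ × ℝ × ℝ => g θ₀ z.2.1 z.2.2) {z | h₀ < z.2.1} :=
        hg.1.comp (f := fun z : ℝ × ℝ × ℝ => (θ₀, z.2.1, z.2.2)) (by fun_prop) fun z hz => hz
      exact continuousOn_const.mul h1
    · rw [abs_mul]
      exact mul_le_mul_of_nonneg_left (hg.2 θ₀ h t hh) (abs_nonneg _)
  induction m generalizing W g with
  | zero => exact base hg
  | succ m ih =>
    obtain ⟨hb, gh, gt, hd, hgh, hgt⟩ := hg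
    exact ⟨base hb, fun _ h t => c * gh θ₀ h t, fun _ h t => c * gt θ₀ h t, fun _ h t hh =>
      ⟨(hd θ₀ h t hh).1.const_mul c, (hd θ₀ h t hh).2.const_mul c⟩,
      (ih hgh).congr hh₀ (fun h _ => le_of_eq (by ring)) fun _ _ _ _ => rfl, ih hgt⟩

theorem iterD_succ_right {h₀ : ℝ} {g gt : ℝ → ℝ → ℝ}
    (hd : ∀ h t, h₀ < h → HasDerivAt (fun τ => g h τ) (gt h t) t) (i j : ℕ) {h : ℝ}
    (hh : h₀ < h) (t : ℝ) : iterD g i (j + 1) h t = iterD gt i j h t := by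
  refine Filter.EventuallyEq.iteratedDeriv_eq i ?_
  filter_upwards [lt_mem_nhds hh] with x hx
  rw [iteratedDeriv_succ', show deriv (g x) = gt x from funext fun τ => (hd x τ hx).deriv]

theorem iterD_succ_left_zero {h₀ : ℝ} {g gh : ℝ → ℝ → ℝ}
    (hd : ∀ h t, h₀ < h → HasDerivAt (fun x => g x t) (gh h t) h) (i : ℕ) {h : ℝ}
    (hh : h₀ < h) (t : ℝ) : iterD g (i + 1) 0 h t = iterD gh i 0 h t := by
  simp only [iterD, iteratedDeriv_zero]
  rw [iteratedDeriv_succ']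
  refine Filter.EventuallyEq.iteratedDeriv_eq i ?_
  filter_upwards [lt_mem_nhds hh] with x hx
  exact (hd x t hx).deriv

theorem WeightedBound.abs_iterD_le {s h₀ : ℝ} {m : ℕ} {W : ℝ → ℝ} {g : ℝ → ℝ → ℝ → ℝ}
    (hg : WeightedBound s h₀ m W g) {i j : ℕ} (hij : i + j ≤ m) (θ : ℝ) {h : ℝ} (hh : h₀ < h)
    (t : ℝ) : |iterD (g θ) i j h t| ≤ (h ^ (-s)) ^ i * W h := by
  induction m generalizing W g i j with
  | zero =>
    obtain ⟨rfl, rfl⟩ : i = 0 ∧ j = 0 := by omega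
    simpa [iterD] using hg.2 θ h t hh
  | succ m ih =>
    obtain ⟨hb, gh, gt, hd, hgh, hgt⟩ := hg
    rcases j with _ | j
    · rcases i with _ | i
      · simpa [iterD] using hb.2 θ h t hh
      · rw [iterD_succ_left_zero (gh := gh θ) (fun h t hh => (hd θ h t hh).1) i hh t]
        refine (ih hgh (by omega)).trans (le_of_eq ?_)
        ring
    · rw [iterD_succ_right (gt := gt θ) (fun h t hh => (hd θ h t hh).2) i j hh t]
      exact ih hgt (by omega)

/-- Mixed partial derivatives commute. -/
theorem hasDerivAt_partial_swap {h₀ : ℝ} {W V : ℝ → ℝ} (hW : ContinuousOn W (Set.Ioi h₀))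
    {g gh gt ght : ℝ → ℝ → ℝ → ℝ} (hgh : BoundedBeyond h₀ V gh) (hght : BoundedBeyond h₀ W ght)
    (hdh : ∀ θ h t, h₀ < h → HasDerivAt (fun x => g θ x t) (gh θ h t) h)
    (hdt : ∀ θ h t, h₀ < h → HasDerivAt (fun τ => g θ h τ) (gt θ h t) t)
    (hdht : ∀ θ h t, h₀ < h → HasDerivAt (fun τ => gh θ h τ) (ght θ h t) t)
    (θ : ℝ) {h : ℝ} (hh : h₀ < h) (t : ℝ) :
    HasDerivAt (fun x => gt θ x t) (ght θ h t) h := by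
  obtain ⟨a, ha, hah⟩ := exists_between hh
  have hcontOn : ∀ {V : ℝ → ℝ} {k : ℝ → ℝ → ℝ → ℝ}, BoundedBeyond h₀ V k → ∀ τ,
      ContinuousOn (fun x => k θ x τ) (Set.Ioi h₀) := fun hk τ =>
    hk.1.comp (f := fun x : ℝ => (θ, x, τ)) (by fun_prop) fun x hx => hx
  have hsub : ∀ x, a < x → Set.uIcc a x ⊆ Set.Ioi h₀ := fun x hx y hy => by
    rw [Set.uIcc_of_le hx.le] at hy
    exact ha.trans_le hy.1
  have key : ∀ x, a < x → gt θ x t = gt θ a t + ∫ y in a..x, ght θ y t := by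
    intro x hx
    have hint : ∀ τ, g θ x τ = g θ a τ + ∫ y in a..x, gh θ y τ := by
      intro τ
      rw [intervalIntegral.integral_eq_sub_of_hasDerivAt
        (fun y hy => hdh θ y τ (hsub x hx hy))
        (((hcontOn hgh τ).mono (hsub x hx)).intervalIntegrable)]
      ring
    have hder : HasDerivAt (fun τ => ∫ y in a..x, gh θ y τ) (∫ y in a..x, ght θ y t) t := by
      have hsub' : Set.uIoc a x ⊆ Set.Ioi h₀ := Set.uIoc_subset_uIcc.trans (hsub x hx)
      refine (intervalIntegral.hasDerivAt_integral_of_dominated_loc_of_deriv_le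
        (s := Set.univ) (bound := W) (F := fun τ y => gh θ y τ)
        (F' := fun τ y => ght θ y τ) Filter.univ_mem ?_ ?_ ?_ ?_ ?_ ?_).2
      · exact Filter.Eventually.of_forall fun τ =>
          ((hcontOn hgh τ).mono hsub').aestronglyMeasurable measurableSet_uIoc
      · exact ((hcontOn hgh t).mono (hsub x hx)).intervalIntegrable
      · exact ((hcontOn hght t).mono hsub').aestronglyMeasurable measurableSet_uIoc
      · exact Filter.Eventually.of_forall fun y hy τ _ => hght.2 θ y τ (hsub' hy)
      · exact (hW.mono (hsub x hx)).intervalIntegrable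
      · exact Filter.Eventually.of_forall fun y hy τ _ => hdht θ y τ (hsub' hy)
    have h1 := (hdt θ a t ha).add hder
    have h2 := hdt θ x t (ha.trans hx)
    rw [show (fun τ => g θ x τ) = fun τ => g θ a τ + ∫ y in a..x, gh θ y τ from
      funext hint] at h2
    exact h2.unique h1
  have hftc : HasDerivAt (fun x => ∫ y in a..x, ght θ y t) (ght θ h t) h := by
    refine intervalIntegral.integral_hasDerivAt_right
      ((hcontOn hght t).mono (hsub h hah)).intervalIntegrable ?_
      ((hcontOn hght t).continuousAt (Ioi_mem_nhds hh))
    exact (hcontOn hght t).stronglyMeasurableAtFilter isOpen_Ioi h hh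
  refine (hftc.const_add (gt θ a t)).congr_of_eventuallyEq ?_
  filter_upwards [lt_mem_nhds hah] with x hx using key x hx

theorem WeightedBound.iterD_succ_left {s h₀ : ℝ} {m : ℕ} {W V : ℝ → ℝ}
    (hV : ContinuousOn V (Set.Ioi h₀)) {g gh : ℝ → ℝ → ℝ → ℝ}
    (hg : WeightedBound s h₀ (m + 1) W g) (hgh : WeightedBound s h₀ m V gh)
    (hd : ∀ θ h t, h₀ < h → HasDerivAt (fun x => g θ x t) (gh θ h t) h)
    {i j : ℕ} (hij : i + j ≤ m) (θ : ℝ) {h : ℝ} (hh : h₀ < h) (t : ℝ) :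
    iterD (g θ) (i + 1) j h t = iterD (gh θ) i j h t := by
  induction j generalizing m g gh W with
  | zero => exact iterD_succ_left_zero (fun h t hh => hd θ h t hh) i hh t
  | succ j ih =>
    obtain ⟨m, rfl⟩ : ∃ n, m = n + 1 := ⟨m - 1, by omega⟩
    obtain ⟨_, _, gt, hdt, _, hgt⟩ := hg
    obtain ⟨hbh, _, ght, hdht, _, hght⟩ := hgh
    rw [iterD_succ_right (gt := gt θ) (fun h t hh => (hdt θ h t hh).2) (i + 1) j hh t,
      iterD_succ_right (gt := ght θ) (fun h t hh => (hdht θ h t hh).2) i j hh t]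
    exact ih hgt hght (fun θ h t hh => hasDerivAt_partial_swap hV hbh hght.base hd
      (fun θ h t hh => (hdt θ h t hh).2) (fun θ h t hh => (hdht θ h t hh).2) θ hh t) (by omega)

theorem ContDiff.fderiv_apply_const {F : ℝ × ℝ → ℝ} {k : ℕ} (hF : ContDiff ℝ (k + 1 : ℕ) F)
    (w : ℝ × ℝ) : ContDiff ℝ k (fun z => fderiv ℝ F z w) :=
  (hF.fderiv_right (m := k) (by norm_cast)).clm_apply contDiff_const

theorem hasDerivAt_slice_left {F : ℝ × ℝ → ℝ} {z : ℝ × ℝ} (hF : DifferentiableAt ℝ F z) :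
    HasDerivAt (fun y => F (y, z.2)) (fderiv ℝ F z (1, 0)) z.1 :=
  hF.hasFDerivAt.comp_hasDerivAt z.1 ((hasDerivAt_id z.1).prodMk (hasDerivAt_const z.1 z.2))

theorem hasDerivAt_slice_right {F : ℝ × ℝ → ℝ} {z : ℝ × ℝ} (hF : DifferentiableAt ℝ F z) :
    HasDerivAt (fun y => F (z.1, y)) (fderiv ℝ F z (0, 1)) z.2 :=
  hF.hasFDerivAt.comp_hasDerivAt z.2 ((hasDerivAt_const z.2 z.1).prodMk (hasDerivAt_id z.2))

theorem contDiff_iterD {n : ℕ} {G : ℝ → ℝ → ℝ} (hG : ContDiff ℝ n (fun z : ℝ × ℝ => G z.1 z.2))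
    {i j k : ℕ} (hk : i + j + k = n) :
    ContDiff ℝ k (fun z : ℝ × ℝ => iterD G i j z.1 z.2) := by
  induction i generalizing k with
  | zero =>
    induction j generalizing k with
    | zero =>
      obtain rfl : k = n := by omega
      exact hG
    | succ j ih =>
      have h1 := ih (k := k + 1) (by omega)
      convert h1.fderiv_apply_const (0, 1) using 1
      funext z
      rw [← (hasDerivAt_slice_right (h1.differentiable (by norm_cast) z)).deriv]
      simp only [iterD, iteratedDeriv_zero]
      rw [iteratedDeriv_succ]
  | succ i ih =>
    have h1 := ih (k := k + 1) (by omega)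
    convert h1.fderiv_apply_const (1, 0) using 1
    funext z
    rw [← (hasDerivAt_slice_left (h1.differentiable (by norm_cast) z)).deriv]
    simp only [iterD]
    rw [iteratedDeriv_succ]

theorem fderiv_iterD_left {n : ℕ} {G : ℝ → ℝ → ℝ}
    (hG : ContDiff ℝ n (fun z : ℝ × ℝ => G z.1 z.2)) {i j : ℕ} (hij : i + j < n) (z : ℝ × ℝ) :
    fderiv ℝ (fun z : ℝ × ℝ => iterD G i j z.1 z.2) z (1, 0) = iterD G (i + 1) j z.1 z.2 := by
  have h1 := contDiff_iterD hG (k := n - (i + j)) (i := i) (j := j) (by omega)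
  rw [← (hasDerivAt_slice_left (h1.differentiable (by norm_cast; omega) z)).deriv]
  simp only [iterD]
  rw [iteratedDeriv_succ]

theorem fderiv_iterD_right {n : ℕ} {G : ℝ → ℝ → ℝ}
    (hG : ContDiff ℝ n (fun z : ℝ × ℝ => G z.1 z.2)) {i j : ℕ} (hij : i + j < n) (z : ℝ × ℝ) :
    fderiv ℝ (fun z : ℝ × ℝ => iterD G i j z.1 z.2) z (0, 1) = iterD G i (j + 1) z.1 z.2 := by
  induction i generalizing z with
  | zero =>
    have h1 := contDiff_iterD hG (k := n - (0 + j)) (i := 0) (j := j) (by omega)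
    rw [← (hasDerivAt_slice_right (h1.differentiable (by norm_cast; omega) z)).deriv]
    simp only [iterD, iteratedDeriv_zero]
    rw [iteratedDeriv_succ]
  | succ i ih =>
    set F := fun z : ℝ × ℝ => iterD G i j z.1 z.2 with hF
    have h1 : ContDiff ℝ (n - (i + j) : ℕ) F := contDiff_iterD hG (by omega)
    have h2 : ContDiffAt ℝ 2 F z :=
      (h1.of_le (by norm_cast; omega : ((2 : ℕ) : WithTop ℕ∞) ≤ _)).contDiffAt
    have hsymm : IsSymmSndFDerivAt ℝ F z := h2.isSymmSndFDerivAt (by simp)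
    have hd : DifferentiableAt ℝ (fderiv ℝ F) z :=
      (h2.fderiv_right (m := 1) (by norm_num)).differentiableAt (by norm_num)
    have hap : ∀ w : ℝ × ℝ, HasFDerivAt (fun z => fderiv ℝ F z w)
        ((fderiv ℝ (fderiv ℝ F) z).flip w) z := fun w => by
      simpa using hd.hasFDerivAt.clm_apply (hasFDerivAt_const w z)
    rw [show (fun z : ℝ × ℝ => iterD G (i + 1) j z.1 z.2) = fun z => fderiv ℝ F z (1, 0) from
        funext fun z => (fderiv_iterD_left hG (by omega) z).symm, (hap _).fderiv,
      ← fderiv_iterD_left hG (by omega),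
      show (fun z : ℝ × ℝ => iterD G i (j + 1) z.1 z.2) = fun z => fderiv ℝ F z (0, 1) from
        funext fun z => (ih (by omega) z).symm, (hap _).fderiv]
    exact hsymm _ _

theorem hasFDerivAt_iterD {n : ℕ} {G : ℝ → ℝ → ℝ}
    (hG : ContDiff ℝ n (fun z : ℝ × ℝ => G z.1 z.2)) {i j : ℕ} (hij : i + j < n) (z : ℝ × ℝ) :
    HasFDerivAt (fun z : ℝ × ℝ => iterD G i j z.1 z.2)
      (iterD G (i + 1) j z.1 z.2 • ContinuousLinearMap.fst ℝ ℝ ℝ +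
        iterD G i (j + 1) z.1 z.2 • ContinuousLinearMap.snd ℝ ℝ ℝ) z := by
  have h1 := contDiff_iterD hG (k := n - (i + j)) (i := i) (j := j) (by omega)
  have h2 := (h1.differentiable (by norm_cast; omega) z).hasFDerivAt
  refine h2.congr_fderiv ?_
  ext
  · simp [fderiv_iterD_left hG hij]
  · simp [fderiv_iterD_right hG hij]

/-- Chain rule for `K (X y, T y)` when `K` has partial derivatives `A`, `B`. -/
theorem HasFDerivAt.hasDerivAt_comp₂ {K : ℝ × ℝ → ℝ} {A B : ℝ} {X T : ℝ → ℝ} {X' T' y : ℝ}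
    (hK : HasFDerivAt K (A • ContinuousLinearMap.fst ℝ ℝ ℝ + B • ContinuousLinearMap.snd ℝ ℝ ℝ)
      (X y, T y)) (hX : HasDerivAt X X' y) (hT : HasDerivAt T T' y) :
    HasDerivAt (fun y => K (X y, T y)) (A * X' + B * T') y := by
  exact (hK.comp_hasDerivAt y (hX.prodMk hT)).congr_deriv (by simp)

/-- Derivative of a function defined implicitly by a Lipschitz selection. -/
theorem hasDerivAt_of_implicit {Φ : ℝ × ℝ → ℝ} {r : ℝ → ℝ} {z₀ A B : ℝ}
    (hΦ : HasFDerivAt Φ (A • ContinuousLinearMap.fst ℝ ℝ ℝ + B • ContinuousLinearMap.snd ℝ ℝ ℝ)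
      (r z₀, z₀)) (hA : A ≠ 0) (hconst : ∀ᶠ z in nhds z₀, Φ (r z, z) = Φ (r z₀, z₀))
    (hO : (fun z => r z - r z₀) =O[nhds z₀] fun z => z - z₀) :
    HasDerivAt r (-B / A) z₀ := by
  have hcont : Filter.Tendsto (fun z => r z - r z₀) (nhds z₀) (nhds 0) :=
    hO.trans_tendsto (by simpa using (continuous_sub_right z₀).tendsto z₀)
  have hcont' : Filter.Tendsto (fun z => (r z, z)) (nhds z₀) (nhds (r z₀, z₀)) := by
    refine Filter.Tendsto.prodMk_nhds ?_ Filter.tendsto_id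
    simpa using hcont.add_const (r z₀)
  have h1 := hΦ.isLittleO.comp_tendsto hcont'
  have h2 : (fun z => (r z, z) - (r z₀, z₀)) =O[nhds z₀] fun z => z - z₀ :=
    hO.prod_left (Asymptotics.isBigO_refl _ _)
  have h3 := h1.trans_isBigO h2
  rw [hasDerivAt_iff_isLittleO]
  refine (h3.const_mul_left (-A⁻¹)).congr' ?_ Filter.EventuallyEq.rfl
  filter_upwards [hconst] with z hz
  simp only [Function.comp, hz]
  simp
  field_simp
  ring

theorem hasDerivAt_posPart_rpow {p : ℝ} (hp : 1 < p) (x : ℝ) :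
    HasDerivAt (fun y : ℝ => max y 0 ^ p) (p * max x 0 ^ (p - 1)) x := by
  rcases lt_trichotomy x 0 with hx | rfl | hx
  · have h1 : (fun y : ℝ => max y 0 ^ p) =ᶠ[nhds x] fun _ => 0 := by
      filter_upwards [gt_mem_nhds hx] with y hy
      rw [max_eq_right hy.le, Real.zero_rpow (by linarith)]
    rw [max_eq_right hx.le, Real.zero_rpow (by linarith), mul_zero]
    exact (hasDerivAt_const x 0).congr_of_eventuallyEq h1
  · have h1 := (hasDerivAt_abs_rpow 0 hp).isLittleO
    simp only [max_self, Real.zero_rpow (by linarith : p - 1 ≠ 0), mul_zero]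
    rw [hasDerivAt_iff_isLittleO]
    refine Asymptotics.IsBigO.trans_isLittleO (Asymptotics.IsBigO.of_bound 1 ?_) h1
    refine Filter.Eventually.of_forall fun y => ?_
    simp only [max_self, abs_zero, Real.zero_rpow (by linarith : p ≠ 0), sub_zero, mul_zero,
      smul_zero, one_mul, Real.norm_eq_abs]
    have h2 : 0 ≤ max y 0 := le_max_right _ _
    rw [abs_of_nonneg (Real.rpow_nonneg h2 _), abs_of_nonneg (Real.rpow_nonneg (abs_nonneg y) _)]
    exact Real.rpow_le_rpow h2 (max_le (le_abs_self y) (abs_nonneg y)) (by linarith)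
  · have h1 : (fun y : ℝ => max y 0 ^ p) =ᶠ[nhds x] fun y => y ^ p := by
      filter_upwards [lt_mem_nhds hx] with y hy
      rw [max_eq_left hy.le]
    rw [max_eq_left hx.le]
    exact (Real.hasDerivAt_rpow_const (Or.inl hx.ne')).congr_of_eventuallyEq h1

theorem mul_rpow_sub_one {p x : ℝ} (hp : 2 ≤ p) (hx : 0 ≤ x) : x * x ^ (p - 1) = x ^ p := by
  rw [← Real.rpow_one_add' hx (by linarith)]
  ring_nf

theorem phi_of_nonneg {p x : ℝ} (hp : 2 ≤ p) (hx : 0 ≤ x) : phi p x = x ^ (p - 1) := by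
  rcases hx.eq_or_lt with rfl | hx
  · simp [phi, Real.zero_rpow (by linarith : p - 1 ≠ 0)]
  · rw [phi, abs_of_pos hx, ← Real.rpow_add_one hx.ne']
    ring_nf

theorem phi_neg (p x : ℝ) : phi p (-x) = -phi p x := by
  simp [phi]

theorem posPart_phi_rpow_sub {p : ℝ} (hp : 2 ≤ p) (x : ℝ) :
    max (phi p x) 0 ^ (1 / (p - 1)) - max (-phi p x) 0 ^ (1 / (p - 1)) = x := by
  have key : ∀ y : ℝ, 0 ≤ y →
      max (phi p y) 0 ^ (1 / (p - 1)) - max (-phi p y) 0 ^ (1 / (p - 1)) = y := fun y hy => by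
    have h1 : 0 < p - 1 := by linarith
    rw [phi_of_nonneg hp hy, max_eq_left (Real.rpow_nonneg hy _),
      max_eq_right (neg_nonpos.2 (Real.rpow_nonneg hy _)), Real.zero_rpow (by positivity),
      ← Real.rpow_mul hy, mul_one_div_cancel h1.ne', Real.rpow_one, sub_zero]
  rcases le_total 0 x with hx | hx
  · exact key x hx
  · have := key (-x) (by linarith)
    rw [phi_neg, neg_neg] at this
    linarith

theorem abs_phi_rpow {p q : ℝ} (hp : 2 ≤ p) (hq : q = p / (p - 1)) (x : ℝ) :
    |phi p x| ^ q = x * phi p x := by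
  have key : ∀ y : ℝ, 0 ≤ y → |phi p y| ^ q = y * phi p y := fun y hy => by
    have h1 : 0 < p - 1 := by linarith
    rw [phi_of_nonneg hp hy, abs_of_nonneg (Real.rpow_nonneg hy _), ← Real.rpow_mul hy, hq,
      mul_div_cancel₀ _ h1.ne', mul_rpow_sub_one hp hy]
  rcases le_total 0 x with hx | hx
  · exact key x hx
  · have := key (-x) (by linarith)
    rwa [phi_neg, abs_neg, neg_mul_neg] at this

theorem abs_phi_rpow_mul {p q : ℝ} (hp : 2 ≤ p) (hq : q = p / (p - 1)) (x : ℝ) :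
    |phi p x| ^ (q - 2) * phi p x = x := by
  rcases eq_or_ne x 0 with rfl | hx
  · simp [phi]
  · have h1 : phi p x ≠ 0 := mul_ne_zero (Real.rpow_pos_of_pos (abs_pos.2 hx) _).ne' hx
    have h2 : |phi p x| ^ (q - 2) * phi p x * phi p x = x * phi p x := by
      rw [← abs_phi_rpow hp hq, mul_assoc, ← abs_mul_abs_self (phi p x), ← pow_two,
        ← Real.rpow_natCast, ← Real.rpow_add (abs_pos.2 h1)]
      norm_num
    exact mul_right_cancel₀ h1 h2

theorem le_one_add_of_rpow_le {x p K : ℝ} (hx : 0 ≤ x) (hp : 1 ≤ p) (h : x ^ p ≤ K) :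
    x ≤ 1 + K := by
  have hK : 0 ≤ K := (Real.rpow_nonneg hx _).trans h
  rcases le_total x 1 with h1 | h1
  · linarith
  · have := Real.rpow_le_rpow_of_exponent_le h1 hp
    rw [Real.rpow_one] at this
    linarith

/-- A `C¹` function `v` with `w = φ_p(v')`, `w' = -u` and conserved energy
`v' w / q + v u / p`, all of `v, v', w, u` being bounded. -/
structure EnergyOrbit (p q : ℝ) (v v' w u : ℝ → ℝ) (M c E : ℝ) : Prop where
  hasDerivAt_v : ∀ θ, HasDerivAt v (v' θ) θ
  hasDerivAt_w : ∀ θ, HasDerivAt w (-u θ) θ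
  hasDerivAt_mul : ∀ θ, HasDerivAt (fun θ => v' θ * w θ) (-(q * u θ * v' θ)) θ
  continuous_v' : Continuous v'
  continuous_u : Continuous u
  one_le_M : 1 ≤ M
  c_pos : 0 < c
  E_pos : 0 < E
  abs_v_le : ∀ θ, |v θ| ≤ M
  abs_v'_le : ∀ θ, |v' θ| ≤ M
  abs_w_le : ∀ θ, |w θ| ≤ M
  abs_u_le : ∀ θ, |u θ| ≤ M
  mul_nonneg : ∀ θ, 0 ≤ v' θ * w θ
  sq_le : ∀ θ, c * w θ ^ 2 ≤ v' θ * w θ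
  vu_nonneg : ∀ θ, 0 ≤ v θ * u θ
  energy : ∀ θ, v' θ * w θ / q + v θ * u θ / p = E

theorem exists_energyOrbit {p q a₁ b₁ : ℝ} {v v' : ℝ → ℝ} (hp : 2 ≤ p) (hq : q = p / (p - 1))
    (ha₁ : 0 < a₁) (hb₁ : 0 < b₁) (hv : ∀ t, HasDerivAt v (v' t) t)
    (hode : ∀ t, HasDerivAt (fun s => phi p (v' s))
      (-a₁ * phi p (max (v t) 0) + b₁ * phi p (max (-v t) 0)) t)
    (hv0 : v 0 = (p - 1) ^ (1 / p)) (hv'0 : v' 0 = 0) :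
    ∃ (w u : ℝ → ℝ) (M c E : ℝ), EnergyOrbit p q v v' w u M c E := by
  have hp1 : 0 < p - 1 := by linarith
  have hp0 : 0 < p := by linarith
  have hq1 : 1 < q := by
    rw [hq, one_lt_div hp1]
    linarith
  set w : ℝ → ℝ := fun θ => phi p (v' θ) with hw
  set u : ℝ → ℝ := fun θ => a₁ * max (v θ) 0 ^ (p - 1) - b₁ * max (-v θ) 0 ^ (p - 1) with hu
  have hw' : ∀ θ, HasDerivAt w (-u θ) θ := fun θ => (hode θ).congr_deriv (by
    rw [phi_of_nonneg hp (le_max_right _ _), phi_of_nonneg hp (le_max_right _ _)]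
    simp only [hu]
    ring)
  have hwc : Continuous w := continuous_iff_continuousAt.2 fun θ => (hw' θ).continuousAt
  have hvc : Continuous v := continuous_iff_continuousAt.2 fun θ => (hv θ).continuousAt
  have hv'c : Continuous v' := by
    have h1 : v' = fun θ => max (w θ) 0 ^ (1 / (p - 1)) - max (-w θ) 0 ^ (1 / (p - 1)) :=
      funext fun θ => (posPart_phi_rpow_sub hp (v' θ)).symm
    rw [h1]
    have h2 : 0 ≤ 1 / (p - 1) := by positivity
    exact ((hwc.max continuous_const).rpow_const fun _ => Or.inr h2).sub
      ((hwc.neg.max continuous_const).rpow_const fun _ => Or.inr h2)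
  have huc : Continuous u :=
    (continuous_const.mul ((hvc.max continuous_const).rpow_const fun _ => Or.inr hp1.le)).sub
      (continuous_const.mul ((hvc.neg.max continuous_const).rpow_const fun _ => Or.inr hp1.le))
  have hN : ∀ θ, |w θ| ^ q = v' θ * w θ := fun θ => abs_phi_rpow hp hq (v' θ)
  have hN' : ∀ θ, HasDerivAt (fun θ => v' θ * w θ) (-(q * u θ * v' θ)) θ := fun θ => by
    have h1 := (hasDerivAt_abs_rpow (w θ) hq1).comp θ (hw' θ)
    have h2 : (fun θ => v' θ * w θ) = (fun x => |x| ^ q) ∘ w := funext fun θ => (hN θ).symm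
    rw [h2]
    refine h1.congr_deriv ?_
    rw [mul_assoc q, abs_phi_rpow_mul hp hq]
    ring
  have hvu : ∀ θ, v θ * u θ = a₁ * max (v θ) 0 ^ p + b₁ * max (-v θ) 0 ^ p := fun θ => by
    rw [← mul_rpow_sub_one hp (le_max_right _ _), ← mul_rpow_sub_one hp (le_max_right (-v θ) _)]
    simp only [hu]
    rcases le_total 0 (v θ) with h | h
    · rw [max_eq_left h, max_eq_right (by linarith : -v θ ≤ 0), Real.zero_rpow hp1.ne']
      ring
    · rw [max_eq_right h, max_eq_left (by linarith : 0 ≤ -v θ), Real.zero_rpow hp1.ne']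
      ring
  have hvu' : ∀ θ, HasDerivAt (fun θ => v θ * u θ) (p * u θ * v' θ) θ := fun θ => by
    rw [funext hvu]
    have h1 := ((hasDerivAt_posPart_rpow (by linarith : 1 < p) (v θ)).comp θ (hv θ)).const_mul a₁
    have h2 := ((hasDerivAt_posPart_rpow (by linarith : 1 < p) (-v θ)).comp θ
      (hv θ).neg).const_mul b₁
    refine (h1.add h2).congr_deriv ?_
    simp only [hu]
    ring
  have hE : ∀ θ, v' θ * w θ / q + v θ * u θ / p = a₁ * (p - 1) / p := fun θ => by
    have h1 : ∀ θ, HasDerivAt (fun θ => v' θ * w θ / q + v θ * u θ / p) 0 θ := fun θ =>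
      (((hN' θ).div_const q).add ((hvu' θ).div_const p)).congr_deriv (by
        field_simp
        ring)
    have h2 := is_const_of_deriv_eq_zero (fun θ => (h1 θ).differentiableAt)
      (fun θ => (h1 θ).deriv) θ 0
    have h3 : 0 ≤ v 0 := hv0 ▸ Real.rpow_nonneg hp1.le _
    rw [h2, hvu, max_eq_left h3, max_eq_right (by linarith), hv'0, hv0, ← Real.rpow_mul hp1.le,
      one_div_mul_cancel hp0.ne', Real.rpow_one, Real.zero_rpow hp0.ne']
    ring
  set E := a₁ * (p - 1) / p with hEdef
  have hE0 : 0 < E := by positivity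
  have hNn : ∀ θ, 0 ≤ v' θ * w θ := fun θ => hN θ ▸ Real.rpow_nonneg (abs_nonneg _) _
  have hpos : ∀ θ, 0 ≤ max (v θ) 0 ^ p := fun θ => Real.rpow_nonneg (le_max_right _ _) _
  have hneg : ∀ θ, 0 ≤ max (-v θ) 0 ^ p := fun θ => Real.rpow_nonneg (le_max_right _ _) _
  have hvun : ∀ θ, 0 ≤ v θ * u θ := fun θ => by
    have := hpos θ
    have := hneg θ
    rw [hvu]
    positivity
  have hNle : ∀ θ, v' θ * w θ ≤ q * E := fun θ => by
    have h1 := hE θ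
    have h2 : 0 ≤ v θ * u θ / p := div_nonneg (hvun θ) hp0.le
    have h3 : v' θ * w θ / q ≤ E := by linarith
    rw [div_le_iff₀ (by linarith)] at h3
    linarith
  have hvule : ∀ θ, v θ * u θ ≤ p * E := fun θ => by
    have h1 := hE θ
    have h2 : 0 ≤ v' θ * w θ / q := div_nonneg (hNn θ) (by linarith)
    have h3 : v θ * u θ / p ≤ E := by linarith
    rw [div_le_iff₀ hp0] at h3
    linarith
  have hpb : ∀ θ, max (v θ) 0 ≤ 1 + p * E / a₁ := fun θ => by
    refine le_one_add_of_rpow_le (le_max_right _ _) (by linarith : 1 ≤ p) ?_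
    have h1 := hvule θ
    rw [hvu] at h1
    rw [le_div_iff₀ ha₁]
    nlinarith [hneg θ]
  have hnb : ∀ θ, max (-v θ) 0 ≤ 1 + p * E / b₁ := fun θ => by
    refine le_one_add_of_rpow_le (le_max_right _ _) (by linarith : 1 ≤ p) ?_
    have h1 := hvule θ
    rw [hvu] at h1
    rw [le_div_iff₀ hb₁]
    nlinarith [hpos θ]
  have hwb : ∀ θ, |w θ| ≤ 1 + q * E := fun θ =>
    le_one_add_of_rpow_le (abs_nonneg _) hq1.le ((hN θ).trans_le (hNle θ))
  have hv'b : ∀ θ, |v' θ| ≤ 1 + q * E := fun θ => by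
    refine le_one_add_of_rpow_le (abs_nonneg _) (by linarith : 1 ≤ p) ?_
    have h1 : |v' θ| ^ p = v' θ * w θ := by
      rw [← abs_of_nonneg (hNn θ), abs_mul]
      simp only [hw, phi, abs_mul]
      rw [abs_of_nonneg (Real.rpow_nonneg (abs_nonneg _) _)]
      rcases (abs_nonneg (v' θ)).eq_or_lt with h | h
      · rw [← h, Real.zero_rpow hp0.ne', zero_mul]
      · rw [← Real.rpow_add_one h.ne', ← Real.rpow_one_add' h.le (by linarith)]
        ring_nf
    exact h1.trans_le (hNle θ)
  have hub : ∀ θ, |u θ| ≤ a₁ * (1 + p * E / a₁) ^ (p - 1) + b₁ * (1 + p * E / b₁) ^ (p - 1) := by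
    intro θ
    have h1 := mul_le_mul_of_nonneg_left (Real.rpow_le_rpow (le_max_right _ _) (hpb θ) hp1.le) ha₁.le
    have h2 := mul_le_mul_of_nonneg_left (Real.rpow_le_rpow (le_max_right _ _) (hnb θ) hp1.le) hb₁.le
    have h3 : 0 ≤ a₁ * max (v θ) 0 ^ (p - 1) :=
      mul_nonneg ha₁.le (Real.rpow_nonneg (le_max_right _ _) _)
    have h4 : 0 ≤ b₁ * max (-v θ) 0 ^ (p - 1) :=
      mul_nonneg hb₁.le (Real.rpow_nonneg (le_max_right _ _) _)
    rw [abs_le]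
    constructor <;> simp only [hu] <;> linarith
  have hvb : ∀ θ, |v θ| ≤ (1 + p * E / a₁) + (1 + p * E / b₁) := fun θ => by
    have h1 := (le_max_left _ _).trans (hpb θ)
    have h2 := (le_max_left _ _).trans (hnb θ)
    have h3 := (le_max_right (v θ) 0).trans (hpb θ)
    have h4 := (le_max_right (-v θ) 0).trans (hnb θ)
    rw [abs_le]
    constructor <;> linarith
  have hq0 : 0 ≤ q * E := mul_nonneg (by linarith) hE0.le
  have hKv : 0 ≤ (1 + p * E / a₁) + (1 + p * E / b₁) := by positivity
  have hKu : 0 ≤ a₁ * (1 + p * E / a₁) ^ (p - 1) + b₁ * (1 + p * E / b₁) ^ (p - 1) := by positivity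
  refine ⟨w, u, (1 + q * E) + ((1 + p * E / a₁) + (1 + p * E / b₁)) +
    (a₁ * (1 + p * E / a₁) ^ (p - 1) + b₁ * (1 + p * E / b₁) ^ (p - 1)),
    ((1 + q * E) ^ (p - 2))⁻¹, E, hv, hw', hN', hv'c, huc, by linarith, by positivity, hE0,
    fun θ => ?_, fun θ => ?_, fun θ => ?_, fun θ => ?_, hNn, fun θ => ?_, hvun, hE⟩
  · linarith [hvb θ]
  · linarith [hv'b θ]
  · linarith [hwb θ]
  · linarith [hub θ]
  · have h1 : w θ ^ 2 = |v' θ| ^ (p - 2) * (v' θ * w θ) := by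
      simp only [hw, phi]
      ring
    have h2 : |v' θ| ^ (p - 2) ≤ (1 + q * E) ^ (p - 2) :=
      Real.rpow_le_rpow (abs_nonneg _) (hv'b θ) (by linarith)
    have h3 : 0 < (1 + q * E) ^ (p - 2) := Real.rpow_pos_of_pos (by linarith) _
    rw [h1, inv_mul_le_iff₀ h3]
    exact mul_le_mul_of_nonneg_right h2 (hNn θ)

namespace EnergyOrbit

variable {p q : ℝ} {v v' w u : ℝ → ℝ} {M c E : ℝ}

theorem continuous_v (O : EnergyOrbit p q v v' w u M c E) : Continuous v :=
  continuous_iff_continuousAt.2 fun θ => (O.hasDerivAt_v θ).continuousAt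

theorem continuous_w (O : EnergyOrbit p q v v' w u M c E) : Continuous w :=
  continuous_iff_continuousAt.2 fun θ => (O.hasDerivAt_w θ).continuousAt

theorem continuous_mul (O : EnergyOrbit p q v v' w u M c E) : Continuous fun θ => v' θ * w θ :=
  O.continuous_v'.mul O.continuous_w

theorem add_mul_pos (O : EnergyOrbit p q v v' w u M c E) {ε : ℝ} (hε : 0 < ε) (θ : ℝ) :
    0 < ε + v' θ * w θ :=
  add_pos_of_pos_of_nonneg hε (O.mul_nonneg θ)

theorem integral_vu_le (O : EnergyOrbit p q v v' w u M c E) {T a : ℝ} (hT : 0 ≤ T) (ha : 0 < a) :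
    ∫ θ in (0 : ℝ)..T, v θ * (u θ / (1 + (a * w θ) ^ 2)) ≤ 2 / a * (2 * M + T * M) := by
  have hvc := O.continuous_v
  have hwc := O.continuous_w
  have huc := O.continuous_u
  have hv'c := O.continuous_v'
  have hM := O.one_le_M
  set Φ : ℝ → ℝ := fun θ => Real.arctan (a * w θ) / a with hΦ
  have hΦ' : ∀ θ, HasDerivAt Φ (-(u θ / (1 + (a * w θ) ^ 2))) θ := fun θ => by
    refine (((O.hasDerivAt_w θ).const_mul a).arctan.div_const a).congr_deriv ?_
    field_simp
  have hΦb : ∀ θ, |Φ θ| ≤ 2 / a := fun θ => by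
    rw [hΦ]
    simp only
    rw [abs_div, abs_of_pos ha]
    gcongr
    have h1 := Real.arctan_lt_pi_div_two (a * w θ)
    have h2 := Real.neg_pi_div_two_lt_arctan (a * w θ)
    have h3 := Real.pi_le_four
    rw [abs_le]
    constructor <;> linarith
  have hcont : Continuous fun θ => u θ / (1 + (a * w θ) ^ 2) :=
    huc.div (by fun_prop) fun θ => by positivity
  have hΦc : Continuous Φ := continuous_iff_continuousAt.2 fun θ => (hΦ' θ).continuousAt
  have hparts := intervalIntegral.integral_mul_deriv_eq_deriv_mul (a := 0) (b := T)
    (fun θ _ => O.hasDerivAt_v θ) (fun θ _ => hΦ' θ) (hv'c.intervalIntegrable _ _)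
    (hcont.neg.intervalIntegrable _ _)
  have h1 : ∫ θ in (0 : ℝ)..T, v θ * (u θ / (1 + (a * w θ) ^ 2)) =
      -(v T * Φ T - v 0 * Φ 0) + ∫ θ in (0 : ℝ)..T, v' θ * Φ θ := by
    have h2 : ∫ θ in (0 : ℝ)..T, v θ * -(u θ / (1 + (a * w θ) ^ 2)) =
        -∫ θ in (0 : ℝ)..T, v θ * (u θ / (1 + (a * w θ) ^ 2)) := by
      rw [← intervalIntegral.integral_neg]
      simp only [mul_neg]
    linarith
  have hb : ∀ {x y : ℝ}, |x| ≤ M → |y| ≤ 2 / a → |x * y| ≤ M * (2 / a) := fun hx hy => by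
    rw [abs_mul]
    exact mul_le_mul hx hy (abs_nonneg _) (by linarith)
  have h3 := abs_le.1 (hb (O.abs_v_le T) (hΦb T))
  have h4 := abs_le.1 (hb (O.abs_v_le 0) (hΦb 0))
  have h5 : ∫ θ in (0 : ℝ)..T, v' θ * Φ θ ≤ M * (2 / a) * (T - 0) := by
    have := intervalIntegral.norm_integral_le_of_norm_le_const (a := 0) (b := T)
      (f := fun θ => v' θ * Φ θ) (C := M * (2 / a)) fun θ _ => hb (O.abs_v'_le θ) (hΦb θ)
    rw [abs_of_nonneg (by linarith : 0 ≤ T - 0)] at this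
    exact (le_abs_self _).trans this
  rw [h1]
  nlinarith [h3.1, h3.2, h4.1, h4.2]

/-- The set of angles where the kinetic energy `v' w` is of size `ε` has measure `O(√ε)`. -/
theorem exists_integral_cutoff_le (O : EnergyOrbit p q v v' w u M c E) (hp : 1 ≤ p) (hq : 1 ≤ q)
    {T : ℝ} (hT : 0 ≤ T) : ∃ K, 0 ≤ K ∧ ∀ ε : ℝ, 0 < ε → ε ≤ 1 →
      ∫ θ in (0 : ℝ)..T, |ε / (ε + v' θ * w θ)| ≤ K * √ε := by
  have hc := O.c_pos
  have hE := O.E_pos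
  have hM := O.one_le_M
  refine ⟨(T + 2 / √c * (2 * M + T * M)) / E, by positivity, fun ε hε hε1 => ?_⟩
  set a := √c / √ε with ha
  have hsε : 0 < √ε := Real.sqrt_pos.2 hε
  have ha0 : 0 < a := div_pos (Real.sqrt_pos.2 hc) hsε
  have ha2 : a ^ 2 = c / ε := by
    rw [ha, div_pow, Real.sq_sqrt hc.le, Real.sq_sqrt hε.le]
  have hvc := O.continuous_v
  have hwc := O.continuous_w
  have huc := O.continuous_u
  have hmc := O.continuous_mul
  have hcont : Continuous fun θ => v θ * (u θ / (1 + (a * w θ) ^ 2)) :=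
    hvc.mul (huc.div (by fun_prop) fun θ => by positivity)
  have hcont' : Continuous fun θ => |ε / (ε + v' θ * w θ)| :=
    (continuous_const.div (by fun_prop) fun θ => (O.add_mul_pos hε θ).ne').abs
  have hpt : ∀ θ, |ε / (ε + v' θ * w θ)| ≤
      (ε + v θ * (u θ / (1 + (a * w θ) ^ 2))) / E := fun θ => by
    have hN := O.mul_nonneg θ
    have hpos := O.add_mul_pos hε θ
    have hvu := O.vu_nonneg θ
    have hen := O.energy θ
    rw [abs_of_nonneg (by positivity), le_div_iff₀ hE]
    set N := v' θ * w θ with hNdef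
    have h1 : ε / (ε + N) ≤ 1 / (1 + (a * w θ) ^ 2) := by
      rw [div_le_div_iff₀ hpos (by positivity), mul_pow, ha2]
      have h2 : ε * (1 + c / ε * w θ ^ 2) = ε + c * w θ ^ 2 := by field_simp
      linarith [O.sq_le θ]
    have h3 : ε / (ε + N) * N ≤ ε := by
      rw [div_mul_eq_mul_div, div_le_iff₀ hpos]
      nlinarith
    have h4 : N / q ≤ N := div_le_self hN hq
    have h5 : v θ * u θ / p ≤ v θ * u θ := div_le_self hvu hp
    have h6 : 0 ≤ ε / (ε + N) := by positivity
    calc ε / (ε + N) * E ≤ ε / (ε + N) * (N + v θ * u θ) :=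
          mul_le_mul_of_nonneg_left (by linarith) h6
      _ = ε / (ε + N) * N + ε / (ε + N) * (v θ * u θ) := by ring
      _ ≤ ε + 1 / (1 + (a * w θ) ^ 2) * (v θ * u θ) :=
          add_le_add h3 (mul_le_mul_of_nonneg_right h1 hvu)
      _ = ε + v θ * (u θ / (1 + (a * w θ) ^ 2)) := by ring
  calc ∫ θ in (0 : ℝ)..T, |ε / (ε + v' θ * w θ)|
      ≤ ∫ θ in (0 : ℝ)..T, (ε + v θ * (u θ / (1 + (a * w θ) ^ 2))) / E :=
        intervalIntegral.integral_mono_on hT (hcont'.intervalIntegrable _ _)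
          (((continuous_const.add hcont).div_const E).intervalIntegrable _ _) fun θ _ => hpt θ
    _ = (T * ε + ∫ θ in (0 : ℝ)..T, v θ * (u θ / (1 + (a * w θ) ^ 2))) / E := by
        rw [intervalIntegral.integral_div, intervalIntegral.integral_add
          (continuous_const.intervalIntegrable _ _) (hcont.intervalIntegrable _ _)]
        simp
    _ ≤ (T * √ε + 2 / a * (2 * M + T * M)) / E := by
        have h1 := O.integral_vu_le hT ha0
        have h2 : ε ≤ √ε := (Real.le_sqrt' hε).2 (by nlinarith)
        have h3 : T * ε ≤ T * √ε := mul_le_mul_of_nonneg_left h2 hT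
        gcongr
    _ = (T + 2 / √c * (2 * M + T * M)) / E * √ε := by
        rw [ha]
        field_simp

theorem abs_multiplier_le (O : EnergyOrbit p q v v' w u M c E) {ε : ℝ} (hε : 0 < ε) (θ : ℝ) :
    |w θ / (ε + v' θ * w θ)| ≤ M / ε := by
  rw [abs_div, abs_of_pos (O.add_mul_pos hε θ)]
  have := O.mul_nonneg θ
  exact div_le_div₀ (by linarith [O.one_le_M]) (O.abs_w_le θ) hε (by linarith)

theorem hasDerivAt_multiplier (O : EnergyOrbit p q v v' w u M c E) {ε : ℝ} (hε : 0 < ε) (θ : ℝ) :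
    HasDerivAt (fun θ => w θ / (ε + v' θ * w θ))
      ((-u θ * (ε + v' θ * w θ) + w θ * (q * u θ * v' θ)) / (ε + v' θ * w θ) ^ 2) θ :=
  ((O.hasDerivAt_w θ).div ((O.hasDerivAt_mul θ).const_add ε)
    (O.add_mul_pos hε θ).ne').congr_deriv (by ring)

theorem continuous_deriv_multiplier (O : EnergyOrbit p q v v' w u M c E) {ε : ℝ} (hε : 0 < ε) :
    Continuous fun θ =>
      (-u θ * (ε + v' θ * w θ) + w θ * (q * u θ * v' θ)) / (ε + v' θ * w θ) ^ 2 := by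
  have hwc := O.continuous_w
  have huc := O.continuous_u
  have hv'c := O.continuous_v'
  exact Continuous.div (by fun_prop) (by fun_prop) fun θ => (pow_pos (O.add_mul_pos hε θ) 2).ne'

theorem abs_deriv_multiplier_le (O : EnergyOrbit p q v v' w u M c E) (hq : 1 ≤ q) {ε : ℝ}
    (hε : 0 < ε) (hε1 : ε ≤ 1) (θ : ℝ) :
    |(-u θ * (ε + v' θ * w θ) + w θ * (q * u θ * v' θ)) / (ε + v' θ * w θ) ^ 2| ≤
      (1 + q) * M ^ 3 / ε ^ 2 := by
  have hN := O.mul_nonneg θ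
  have hpos := O.add_mul_pos hε θ
  have hM := O.one_le_M
  have h1 : |(-u θ * (ε + v' θ * w θ) + w θ * (q * u θ * v' θ)) / (ε + v' θ * w θ) ^ 2| ≤
      |u θ / (ε + v' θ * w θ)| + |w θ * (q * u θ * v' θ) / (ε + v' θ * w θ) ^ 2| := by
    rw [← abs_neg (u θ / (ε + v' θ * w θ))]
    refine le_trans (le_of_eq ?_) (abs_add_le _ _)
    congr 1
    field_simp
  have h2 : |u θ / (ε + v' θ * w θ)| ≤ M / ε := by
    rw [abs_div, abs_of_pos hpos]
    exact div_le_div₀ (by linarith) (O.abs_u_le θ) hε (by linarith)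
  have h3 : |w θ * (q * u θ * v' θ) / (ε + v' θ * w θ) ^ 2| ≤ q * M ^ 3 / ε ^ 2 := by
    rw [abs_div, abs_of_pos (pow_pos hpos 2)]
    refine div_le_div₀ (by positivity) ?_ (by positivity) (pow_le_pow_left₀ hε.le (by linarith) 2)
    rw [abs_mul, abs_mul, abs_mul, abs_of_nonneg (by linarith : 0 ≤ q)]
    have h4 := mul_le_mul (mul_le_mul (O.abs_w_le θ) (O.abs_u_le θ) (abs_nonneg _)
      (by linarith)) (O.abs_v'_le θ) (abs_nonneg _) (by positivity)
    calc |w θ| * (q * |u θ| * |v' θ|) = q * (|w θ| * |u θ| * |v' θ|) := by ring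
      _ ≤ q * (M * M * M) := mul_le_mul_of_nonneg_left h4 (by linarith)
      _ = q * M ^ 3 := by ring
  have h5 : M / ε ≤ M ^ 3 / ε ^ 2 :=
    div_le_div₀ (by positivity) (le_self_pow₀ hM (by norm_num)) (by positivity) (by nlinarith)
  calc _ ≤ M ^ 3 / ε ^ 2 + q * M ^ 3 / ε ^ 2 := by linarith
    _ = (1 + q) * M ^ 3 / ε ^ 2 := by ring

end EnergyOrbit

/-- `r` solves `r + b K(D r^α v(θ), t) = ω h` for `h > h₀`, where the perturbation is a
contraction in `r`. -/
structure ImplicitRadius (α ω b D L M h₀ : ℝ) (v v' : ℝ → ℝ) (K Kx Kt : ℝ → ℝ → ℝ)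
    (r : ℝ → ℝ → ℝ → ℝ) : Prop where
  α_pos : 0 < α
  α_le : α ≤ 1 / 2
  ω_pos : 0 < ω
  D_pos : 0 < D
  one_le : 1 ≤ h₀
  hasFDerivAt_K : ∀ z : ℝ × ℝ, HasFDerivAt (fun z : ℝ × ℝ => K z.1 z.2)
    (Kx z.1 z.2 • ContinuousLinearMap.fst ℝ ℝ ℝ + Kt z.1 z.2 • ContinuousLinearMap.snd ℝ ℝ ℝ) z
  abs_Kx_le : ∀ x t, |Kx x t| ≤ L
  hasDerivAt_v : ∀ θ, HasDerivAt v (v' θ) θ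
  abs_v_le : ∀ θ, |v θ| ≤ M
  small : |b| * L * (D * α * (ω * h₀ / 2) ^ (α - 1) * M) ≤ 1 / 2
  mem : ∀ θ h t, h₀ < h → r θ h t ∈ Set.Icc (ω * h / 2) (3 * (ω * h) / 2)
  eq : ∀ θ h t, h₀ < h → r θ h t + b * K (D * r θ h t ^ α * v θ) t = ω * h

namespace ImplicitRadius

variable {α ω b D L M h₀ : ℝ} {v v' : ℝ → ℝ} {K Kx Kt : ℝ → ℝ → ℝ} {r : ℝ → ℝ → ℝ → ℝ}

theorem pos (S : ImplicitRadius α ω b D L M h₀ v v' K Kx Kt r) {h : ℝ} (hh : h₀ < h) (θ t : ℝ) :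
    0 < r θ h t := by
  have h1 : 0 < ω * h := mul_pos S.ω_pos (by linarith [S.one_le])
  linarith [(S.mem θ h t hh).1]

theorem half_le (S : ImplicitRadius α ω b D L M h₀ v v' K Kx Kt r) {h : ℝ} (hh : h₀ < h)
    (θ t : ℝ) : ω * h₀ / 2 ≤ r θ h t := by
  have h1 : ω * h₀ ≤ ω * h := mul_le_mul_of_nonneg_left hh.le S.ω_pos.le
  linarith [(S.mem θ h t hh).1]

theorem half_pos (S : ImplicitRadius α ω b D L M h₀ v v' K Kx Kt r) : 0 < ω * h₀ / 2 := by
  have h1 : 0 < ω * h₀ := mul_pos S.ω_pos (by linarith [S.one_le])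
  linarith

theorem abs_slope_le (S : ImplicitRadius α ω b D L M h₀ v v' K Kx Kt r) {ρ : ℝ}
    (hρ : ω * h₀ / 2 ≤ ρ) (θ x t : ℝ) :
    |b * (Kx x t * (D * (α * ρ ^ (α - 1)) * v θ))| ≤ 1 / 2 := by
  have hα := S.α_pos
  have hD := S.D_pos
  have h0 := S.half_pos
  have hL : 0 ≤ L := (abs_nonneg _).trans (S.abs_Kx_le 0 0)
  have h1 : ρ ^ (α - 1) ≤ (ω * h₀ / 2) ^ (α - 1) :=
    Real.rpow_le_rpow_of_nonpos h0 hρ (by linarith [S.α_le])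
  have h2 : 0 ≤ ρ ^ (α - 1) := Real.rpow_nonneg (by linarith) _
  have h3 : |D * (α * ρ ^ (α - 1)) * v θ| ≤ D * α * (ω * h₀ / 2) ^ (α - 1) * M := by
    rw [abs_mul, abs_of_nonneg (by positivity)]
    refine mul_le_mul ?_ (S.abs_v_le θ) (abs_nonneg _) (by positivity)
    rw [mul_assoc]
    gcongr
  refine le_trans ?_ S.small
  rw [abs_mul, abs_mul (Kx x t), mul_assoc |b|]
  exact mul_le_mul_of_nonneg_left
    (mul_le_mul (S.abs_Kx_le _ _) h3 (abs_nonneg _) hL) (abs_nonneg _)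

theorem abs_sub_le (S : ImplicitRadius α ω b D L M h₀ v v' K Kx Kt r) {ρ₁ ρ₂ : ℝ}
    (hρ₁ : ω * h₀ / 2 ≤ ρ₁) (hρ₂ : ω * h₀ / 2 ≤ ρ₂) (θ t : ℝ) :
    |ρ₁ - ρ₂| ≤ 2 * |(ρ₁ + b * K (D * ρ₁ ^ α * v θ) t) - (ρ₂ + b * K (D * ρ₂ ^ α * v θ) t)| := by
  have h1 := Convex.norm_image_sub_le_of_norm_hasDerivWithin_le
    (f := fun ρ => b * K (D * ρ ^ α * v θ) t)
    (f' := fun ρ => b * (Kx (D * ρ ^ α * v θ) t * (D * (α * ρ ^ (α - 1)) * v θ)))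
    (s := Set.Ici (ω * h₀ / 2)) (x := ρ₂) (y := ρ₁) (C := 1 / 2) (fun ρ hρ => ?_)
    (fun ρ hρ => S.abs_slope_le hρ _ _ _) (convex_Ici _) hρ₂ hρ₁
  · simp only [Real.norm_eq_abs] at h1
    have h2 := abs_sub_abs_le_abs_sub (ρ₁ - ρ₂)
      (-(b * K (D * ρ₁ ^ α * v θ) t - b * K (D * ρ₂ ^ α * v θ) t))
    rw [abs_neg] at h2
    have h3 : (ρ₁ - ρ₂) - -(b * K (D * ρ₁ ^ α * v θ) t - b * K (D * ρ₂ ^ α * v θ) t) =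
      (ρ₁ + b * K (D * ρ₁ ^ α * v θ) t) - (ρ₂ + b * K (D * ρ₂ ^ α * v θ) t) := by ring
    rw [h3] at h2
    linarith
  · have h0 : 0 < ρ := S.half_pos.trans_le hρ
    have h2 : HasDerivAt (fun ρ : ℝ => D * ρ ^ α * v θ) (D * (α * ρ ^ (α - 1)) * v θ) ρ :=
      ((Real.hasDerivAt_rpow_const (Or.inl h0.ne')).const_mul D).mul_const _
    have h3 := ((S.hasFDerivAt_K (D * ρ ^ α * v θ, t)).hasDerivAt_comp₂ h2
      (hasDerivAt_const ρ t)).const_mul b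
    simp only [mul_zero, add_zero] at h3
    exact h3.hasDerivWithinAt

theorem isBigO_sub (S : ImplicitRadius α ω b D L M h₀ v v' K Kx Kt r) {h : ℝ} (hh : h₀ < h)
    (θ t : ℝ) : (fun z : ℝ × ℝ × ℝ => r z.1 z.2.1 z.2.2 - r θ h t) =O[nhds (θ, h, t)]
      fun z => z - (θ, h, t) := by
  set ρ := r θ h t with hρ
  have hd : DifferentiableAt ℝ
      (fun z : ℝ × ℝ × ℝ => ρ + b * K (D * ρ ^ α * v z.1) z.2.2 - ω * z.2.1) (θ, h, t) := by
    have h1 : DifferentiableAt ℝ (fun z : ℝ × ℝ × ℝ => v z.1) (θ, h, t) :=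
      DifferentiableAt.comp (f := fun z : ℝ × ℝ × ℝ => z.1) (θ, h, t)
        (S.hasDerivAt_v θ).differentiableAt differentiableAt_fst
    have h2 : DifferentiableAt ℝ (fun z : ℝ × ℝ × ℝ => (D * ρ ^ α * v z.1, z.2.2)) (θ, h, t) :=
      (h1.const_mul _).prodMk (by fun_prop)
    have h3 : DifferentiableAt ℝ (fun z : ℝ × ℝ × ℝ => K (D * ρ ^ α * v z.1) z.2.2) (θ, h, t) :=
      DifferentiableAt.comp (g := fun z : ℝ × ℝ => K z.1 z.2) (θ, h, t) (S.hasFDerivAt_K (D * ρ ^ α * v θ, t)).differentiableAt h2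
    exact ((h3.const_mul b).const_add ρ).sub (by fun_prop)
  refine Asymptotics.IsBigO.trans (Asymptotics.IsBigO.of_bound 2 ?_) hd.isBigO_sub
  filter_upwards [(isOpen_beyond h₀).mem_nhds (show (θ, h, t) ∈ _ from hh)] with z hz
  have h1 := S.abs_sub_le (S.half_le hz z.1 z.2.2) (S.half_le hh θ t) z.1 z.2.2
  rw [S.eq _ _ _ hz] at h1
  have h2 := S.eq θ h t hh
  rw [← hρ] at h1 h2
  simp only [Real.norm_eq_abs]
  refine h1.trans (le_of_eq ?_)
  rw [h2, sub_self, sub_zero, abs_sub_comm]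

theorem continuousOn (S : ImplicitRadius α ω b D L M h₀ v v' K Kx Kt r) :
    ContinuousOn (fun z : ℝ × ℝ × ℝ => r z.1 z.2.1 z.2.2) {z | h₀ < z.2.1} := by
  rintro ⟨θ, h, t⟩ hh
  refine ContinuousAt.continuousWithinAt ?_
  have h1 := (S.isBigO_sub hh θ t).trans_tendsto
    (by simpa using (continuous_sub_right (θ, h, t)).tendsto (θ, h, t))
  have h2 := h1.add_const (r θ h t)
  simpa [ContinuousAt] using h2

/-- The `r`-derivative of the implicit equation. -/
noncomputable def jac (α b D : ℝ) (v : ℝ → ℝ) (Kx : ℝ → ℝ → ℝ) (r : ℝ → ℝ → ℝ → ℝ)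
    (θ h t : ℝ) : ℝ :=
  1 + b * (Kx (D * r θ h t ^ α * v θ) t * (D * (α * r θ h t ^ (α - 1)) * v θ))

theorem jac_mem (S : ImplicitRadius α ω b D L M h₀ v v' K Kx Kt r) (θ : ℝ) {h : ℝ} (hh : h₀ < h)
    (t : ℝ) : jac α b D v Kx r θ h t ∈ Set.Icc (1 / 2 : ℝ) (3 / 2) := by
  have := abs_le.1 (S.abs_slope_le (S.half_le hh θ t) θ (D * r θ h t ^ α * v θ) t)
  rw [jac]
  constructor <;> linarith [this.1, this.2]

/-- Derivative of `r` along a curve `(V, H, T)` in `(θ, h, t)`-space. -/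
theorem hasDerivAt_along (S : ImplicitRadius α ω b D L M h₀ v v' K Kx Kt r) {Θ H T : ℝ → ℝ}
    {Θ' H' T' z₀ : ℝ} (hΘ : HasDerivAt Θ Θ' z₀) (hH : HasDerivAt H H' z₀)
    (hT : HasDerivAt T T' z₀) (hh : h₀ < H z₀) :
    HasDerivAt (fun z => r (Θ z) (H z) (T z))
      (-(b * (Kx (D * r (Θ z₀) (H z₀) (T z₀) ^ α * v (Θ z₀)) (T z₀) *
          (D * r (Θ z₀) (H z₀) (T z₀) ^ α * (v' (Θ z₀) * Θ')) +
          Kt (D * r (Θ z₀) (H z₀) (T z₀) ^ α * v (Θ z₀)) (T z₀) * T') - ω * H') /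
        jac α b D v Kx r (Θ z₀) (H z₀) (T z₀)) z₀ := by
  set ρ := r (Θ z₀) (H z₀) (T z₀) with hρ
  have hρ0 : 0 < ρ := S.pos hh _ _
  have hfst : HasFDerivAt (fun y : ℝ × ℝ => y.1) (ContinuousLinearMap.fst ℝ ℝ ℝ) (ρ, z₀) :=
    hasFDerivAt_fst
  have hsnd : HasFDerivAt (fun y : ℝ × ℝ => y.2) (ContinuousLinearMap.snd ℝ ℝ ℝ) (ρ, z₀) :=
    hasFDerivAt_snd
  have hpow : HasFDerivAt (fun y : ℝ × ℝ => D * y.1 ^ α)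
      ((D * (α * ρ ^ (α - 1))) • ContinuousLinearMap.fst ℝ ℝ ℝ) (ρ, z₀) :=
    HasDerivAt.comp_hasFDerivAt (h₂ := fun x : ℝ => D * x ^ α) (f := fun y : ℝ × ℝ => y.1) (ρ, z₀)
      ((Real.hasDerivAt_rpow_const (p := α) (Or.inl hρ0.ne')).const_mul D) hfst
  have hvΘ : HasFDerivAt (fun y : ℝ × ℝ => v (Θ y.2))
      ((v' (Θ z₀) * Θ') • ContinuousLinearMap.snd ℝ ℝ ℝ) (ρ, z₀) :=
    HasDerivAt.comp_hasFDerivAt (h₂ := fun z => v (Θ z)) (f := fun y : ℝ × ℝ => y.2) (ρ, z₀)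
      ((S.hasDerivAt_v _).comp z₀ hΘ) hsnd
  have hT2 : HasFDerivAt (fun y : ℝ × ℝ => T y.2) (T' • ContinuousLinearMap.snd ℝ ℝ ℝ) (ρ, z₀) :=
    HasDerivAt.comp_hasFDerivAt (f := fun y : ℝ × ℝ => y.2) (ρ, z₀) hT hsnd
  have hH2 : HasFDerivAt (fun y : ℝ × ℝ => H y.2) (H' • ContinuousLinearMap.snd ℝ ℝ ℝ) (ρ, z₀) :=
    HasDerivAt.comp_hasFDerivAt (f := fun y : ℝ × ℝ => y.2) (ρ, z₀) hH hsnd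
  have hX := hpow.mul hvΘ
  have hK := HasFDerivAt.comp (f := fun y : ℝ × ℝ => (D * y.1 ^ α * v (Θ y.2), T y.2)) (ρ, z₀)
    (S.hasFDerivAt_K (D * ρ ^ α * v (Θ z₀), T z₀)) (hX.prodMk hT2)
  have hall := (hfst.add (hK.const_mul b)).sub (hH2.const_mul ω)
  refine hasDerivAt_of_implicit
    (Φ := fun y => y.1 + b * K (D * y.1 ^ α * v (Θ y.2)) (T y.2) - ω * H y.2)
    (r := fun z => r (Θ z) (H z) (T z)) (hall.congr_fderiv ?_) ?_ ?_ ?_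
  · rw [jac, ← hρ]
    ext
    · simp [-mul_eq_mul_left_iff]
      ring
    · simp
      ring
  · have := (S.jac_mem (Θ z₀) hh (T z₀)).1
    linarith
  · filter_upwards [hH.continuousAt.eventually (lt_mem_nhds hh)] with z hz
    rw [S.eq _ _ _ hz]
    have := S.eq (Θ z₀) (H z₀) (T z₀) hh
    linarith
  · have hc : Filter.Tendsto (fun z => (Θ z, H z, T z)) (nhds z₀) (nhds (Θ z₀, H z₀, T z₀)) :=
      hΘ.continuousAt.prodMk_nhds (hH.continuousAt.prodMk_nhds hT.continuousAt)
    have h1 := (S.isBigO_sub hh (Θ z₀) (T z₀)).comp_tendsto hc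
    exact h1.trans (hΘ.differentiableAt.isBigO_sub.prod_left
      (hH.differentiableAt.isBigO_sub.prod_left hT.differentiableAt.isBigO_sub))

end ImplicitRadius

/-- An `ImplicitRadius` for the perturbation `G(x,t) - x F₀(t)`, where `G` has bounded derivatives
up to order `n` and `F k` is the bounded `k`-th derivative of `F 0`. -/
structure PerturbedRadius (n : ℕ) (α ω b D L M C h₀ : ℝ) (v v' : ℝ → ℝ) (G : ℝ → ℝ → ℝ)
    (F : ℕ → ℝ → ℝ) (r : ℝ → ℝ → ℝ → ℝ) : Prop extends
    ImplicitRadius α ω b D L M h₀ v v' (fun x t => G x t - x * F 0 t)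
      (fun x t => iterD G 1 0 x t - F 0 t) (fun x t => iterD G 0 1 x t - x * F 1 t) r where
  contDiff_G : ContDiff ℝ n (fun z : ℝ × ℝ => G z.1 z.2)
  abs_iterD_G_le : ∀ i j : ℕ, i + j ≤ n → ∀ x t : ℝ, |iterD G i j x t| ≤ C
  hasDerivAt_F : ∀ k, k < n + 1 → ∀ t, HasDerivAt (F k) (F (k + 1) t) t
  continuous_F : ∀ k, k ≤ n + 1 → Continuous (F k)
  exists_abs_F_le : ∀ k, k ≤ n + 1 → ∃ K, ∀ t, |F k t| ≤ K
  continuous_v' : Continuous v'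
  abs_v'_le : ∀ θ, |v' θ| ≤ M

namespace PerturbedRadius

open ImplicitRadius

variable {n : ℕ} {α ω b D L M C h₀ : ℝ} {v v' : ℝ → ℝ} {G : ℝ → ℝ → ℝ} {F : ℕ → ℝ → ℝ}
  {r : ℝ → ℝ → ℝ → ℝ}

theorem nonneg (S : PerturbedRadius n α ω b D L M C h₀ v v' G F r) : 0 ≤ h₀ :=
  zero_le_one.trans S.one_le

theorem isSymbol_F (S : PerturbedRadius n α ω b D L M C h₀ v v' G F r) {m k : ℕ}
    (hmk : m + k ≤ n + 1) : IsSymbol (1 - α) h₀ m 0 (fun _ _ t => F k t) :=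
  IsSymbol.of_time S.nonneg S.hasDerivAt_F S.continuous_F S.exists_abs_F_le hmk

theorem continuous_v (S : PerturbedRadius n α ω b D L M C h₀ v v' G F r) : Continuous v :=
  continuous_iff_continuousAt.2 fun θ => (S.hasDerivAt_v θ).continuousAt

theorem isSymbol_v (S : PerturbedRadius n α ω b D L M C h₀ v v' G F r) (m : ℕ) :
    IsSymbol (1 - α) h₀ m 0 (fun θ _ _ => v θ) :=
  IsSymbol.of_index S.nonneg S.continuous_v S.abs_v_le m

theorem isSymbol_v' (S : PerturbedRadius n α ω b D L M C h₀ v v' G F r) (m : ℕ) :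
    IsSymbol (1 - α) h₀ m 0 (fun θ _ _ => v' θ) :=
  IsSymbol.of_index S.nonneg S.continuous_v' S.abs_v'_le m

theorem ratio_mem (S : PerturbedRadius n α ω b D L M C h₀ v v' G F r) (θ h t : ℝ) (hh : h₀ < h) :
    r θ h t / (ω * h) ∈ Set.Icc (1 / 2 : ℝ) (3 / 2) := by
  have h1 : 0 < ω * h := mul_pos S.ω_pos (S.nonneg.trans_lt hh)
  have h2 := S.mem θ h t hh
  constructor
  · rw [le_div_iff₀ h1]
    linarith [h2.1]
  · rw [div_le_iff₀ h1]
    linarith [h2.2]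

/-- The symbols generated by differentiating `m` times: `r / (ω h)` and `D^{i,j} G(D r^α v, t)`. -/
def Core (α ω D h₀ : ℝ) (v : ℝ → ℝ) (G : ℝ → ℝ → ℝ) (r : ℝ → ℝ → ℝ → ℝ) (n m : ℕ) : Prop :=
  IsSymbol (1 - α) h₀ m 0 (fun θ h t => r θ h t / (ω * h)) ∧
    ∀ i j, i + j + m ≤ n →
      IsSymbol (1 - α) h₀ m 0 (fun θ h t => iterD G i j (D * r θ h t ^ α * v θ) t)

section Core

variable {m : ℕ}

theorem isSymbol_rpow (S : PerturbedRadius n α ω b D L M C h₀ v v' G F r)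
    (hc : Core α ω D h₀ v G r n m) (β : ℝ) :
    IsSymbol (1 - α) h₀ m β (fun θ h t => r θ h t ^ β) := by
  have h1 := hc.1.rpow S.nonneg S.ratio_mem β
  have h2 := (IsSymbol.rpow_self (s := 1 - α) (by linarith [S.α_pos]) S.one_le m β).mul S.nonneg
    (h1.const_mul S.nonneg (ω ^ β)) (add_zero β)
  refine h2.congr S.nonneg fun θ h t hh => ?_
  have h3 : 0 < h := S.nonneg.trans_lt hh
  have h4 := S.ω_pos
  rw [← mul_assoc, mul_comm (h ^ β), ← Real.mul_rpow h4.le h3.le,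
    ← Real.mul_rpow (by positivity) (div_nonneg (S.pos hh θ t).le (by positivity)),
    mul_div_cancel₀ _ (by positivity)]

theorem isSymbol_X (S : PerturbedRadius n α ω b D L M C h₀ v v' G F r)
    (hc : Core α ω D h₀ v G r n m) :
    IsSymbol (1 - α) h₀ m α (fun θ h t => D * r θ h t ^ α * v θ) :=
  ((S.isSymbol_rpow hc α).const_mul S.nonneg D).mul S.nonneg (S.isSymbol_v m) (add_zero α)

theorem isSymbol_jac (S : PerturbedRadius n α ω b D L M C h₀ v v' G F r)
    (hc : Core α ω D h₀ v G r n m) (hm : m + 1 ≤ n) :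
    IsSymbol (1 - α) h₀ m (α - 1)
      (fun θ h t => jac α b D v (fun x t => iterD G 1 0 x t - F 0 t) r θ h t - 1) := by
  have h1 := (hc.2 1 0 (by omega)).sub S.nonneg (S.isSymbol_F (m := m) (k := 0) (by omega))
  have h2 := (((S.isSymbol_rpow hc (α - 1)).const_mul S.nonneg α).const_mul S.nonneg D).mul
    S.nonneg (S.isSymbol_v m) (add_zero _)
  refine ((h1.mul S.nonneg h2 (zero_add _)).const_mul S.nonneg b).congr S.nonneg
    fun θ h t hh => ?_
  simp only [jac]
  ring

theorem isSymbol_jac_rpow_sub_one (S : PerturbedRadius n α ω b D L M C h₀ v v' G F r)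
    (hc : Core α ω D h₀ v G r n m) (hm : m + 1 ≤ n) :
    IsSymbol (1 - α) h₀ m (α - 1)
      (fun θ h t => jac α b D v (fun x t => iterD G 1 0 x t - F 0 t) r θ h t ^ (-1 : ℝ) - 1) := by
  have h1 := S.isSymbol_jac hc hm
  have h2 : IsSymbol (1 - α) h₀ m 0
      (fun θ h t => jac α b D v (fun x t => iterD G 1 0 x t - F 0 t) r θ h t) :=
    ((h1.mono S.one_le (by linarith [S.α_le])).add S.nonneg
      (IsSymbol.const S.nonneg 1 m)).congr S.nonneg fun θ h t _ => by ring
  exact h2.rpow_sub_one S.nonneg h1 (fun θ h t hh => S.jac_mem θ hh t) _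

theorem isSymbol_jac_rpow (S : PerturbedRadius n α ω b D L M C h₀ v v' G F r)
    (hc : Core α ω D h₀ v G r n m) (hm : m + 1 ≤ n) :
    IsSymbol (1 - α) h₀ m 0
      (fun θ h t => jac α b D v (fun x t => iterD G 1 0 x t - F 0 t) r θ h t ^ (-1 : ℝ)) :=
  (((S.isSymbol_jac_rpow_sub_one hc hm).mono S.one_le (by linarith [S.α_le])).add S.nonneg
    (IsSymbol.const S.nonneg 1 m)).congr S.nonneg fun θ h t _ => by ring

/-- `∂r/∂h` -/
noncomputable def rh (α ω b D : ℝ) (v : ℝ → ℝ) (G : ℝ → ℝ → ℝ) (F : ℕ → ℝ → ℝ)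
    (r : ℝ → ℝ → ℝ → ℝ) (θ h t : ℝ) : ℝ :=
  ω * jac α b D v (fun x t => iterD G 1 0 x t - F 0 t) r θ h t ^ (-1 : ℝ)

/-- `∂r/∂t` -/
noncomputable def rt (α b D : ℝ) (v : ℝ → ℝ) (G : ℝ → ℝ → ℝ) (F : ℕ → ℝ → ℝ)
    (r : ℝ → ℝ → ℝ → ℝ) (θ h t : ℝ) : ℝ :=
  -b * (iterD G 0 1 (D * r θ h t ^ α * v θ) t - D * r θ h t ^ α * v θ * F 1 t) *
    jac α b D v (fun x t => iterD G 1 0 x t - F 0 t) r θ h t ^ (-1 : ℝ)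

/-- `∂r/∂θ` -/
noncomputable def rθ (α b D : ℝ) (v v' : ℝ → ℝ) (G : ℝ → ℝ → ℝ) (F : ℕ → ℝ → ℝ)
    (r : ℝ → ℝ → ℝ → ℝ) (θ h t : ℝ) : ℝ :=
  -b * ((iterD G 1 0 (D * r θ h t ^ α * v θ) t - F 0 t) * (D * r θ h t ^ α * v' θ)) *
    jac α b D v (fun x t => iterD G 1 0 x t - F 0 t) r θ h t ^ (-1 : ℝ)

theorem hasDerivAt_h (S : PerturbedRadius n α ω b D L M C h₀ v v' G F r) (θ h t : ℝ)
    (hh : h₀ < h) : HasDerivAt (fun x => r θ x t) (rh α ω b D v G F r θ h t) h := by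
  refine (S.hasDerivAt_along (hasDerivAt_const h θ) (hasDerivAt_id' h)
    (hasDerivAt_const h t) hh).congr_deriv ?_
  rw [rh, Real.rpow_neg_one]
  ring

theorem hasDerivAt_t (S : PerturbedRadius n α ω b D L M C h₀ v v' G F r) (θ h t : ℝ)
    (hh : h₀ < h) : HasDerivAt (fun τ => r θ h τ) (rt α b D v G F r θ h t) t := by
  refine (S.hasDerivAt_along (hasDerivAt_const t θ) (hasDerivAt_const t h)
    (hasDerivAt_id' t) hh).congr_deriv ?_
  rw [rt, Real.rpow_neg_one]
  ring

theorem hasDerivAt_θ (S : PerturbedRadius n α ω b D L M C h₀ v v' G F r) (θ h t : ℝ)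
    (hh : h₀ < h) : HasDerivAt (fun y => r y h t) (rθ α b D v v' G F r θ h t) θ := by
  refine (S.hasDerivAt_along (hasDerivAt_id' θ) (hasDerivAt_const θ h)
    (hasDerivAt_const θ t) hh).congr_deriv ?_
  rw [rθ, Real.rpow_neg_one]
  ring

theorem isSymbol_rh (S : PerturbedRadius n α ω b D L M C h₀ v v' G F r)
    (hc : Core α ω D h₀ v G r n m) (hm : m + 1 ≤ n) :
    IsSymbol (1 - α) h₀ m 0 (rh α ω b D v G F r) :=
  (S.isSymbol_jac_rpow hc hm).const_mul S.nonneg ω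

theorem isSymbol_rh_sub (S : PerturbedRadius n α ω b D L M C h₀ v v' G F r)
    (hc : Core α ω D h₀ v G r n m) (hm : m + 1 ≤ n) :
    IsSymbol (1 - α) h₀ m (α - 1) (fun θ h t => rh α ω b D v G F r θ h t - ω) :=
  ((S.isSymbol_jac_rpow_sub_one hc hm).const_mul S.nonneg ω).congr S.nonneg fun θ h t _ => by
    rw [rh]
    ring

theorem isSymbol_rt (S : PerturbedRadius n α ω b D L M C h₀ v v' G F r)
    (hc : Core α ω D h₀ v G r n m) (hm : m + 1 ≤ n) :
    IsSymbol (1 - α) h₀ m α (rt α b D v G F r) := by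
  have h1 := ((hc.2 0 1 (by omega)).mono S.one_le S.α_pos.le).sub S.nonneg
    ((S.isSymbol_X hc).mul S.nonneg (S.isSymbol_F (m := m) (k := 1) (by omega)) (add_zero α))
  exact (h1.const_mul S.nonneg (-b)).mul S.nonneg (S.isSymbol_jac_rpow hc hm) (add_zero α)

theorem isSymbol_rθ (S : PerturbedRadius n α ω b D L M C h₀ v v' G F r)
    (hc : Core α ω D h₀ v G r n m) (hm : m + 1 ≤ n) :
    IsSymbol (1 - α) h₀ m α (rθ α b D v v' G F r) := by
  have h1 := (hc.2 1 0 (by omega)).sub S.nonneg (S.isSymbol_F (m := m) (k := 0) (by omega))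
  have h2 := ((S.isSymbol_rpow hc α).const_mul S.nonneg D).mul S.nonneg (S.isSymbol_v' m)
    (add_zero α)
  exact ((h1.mul S.nonneg h2 (zero_add α)).const_mul S.nonneg (-b)).mul S.nonneg
    (S.isSymbol_jac_rpow hc hm) (add_zero α)

theorem hasDerivAt_X_h (S : PerturbedRadius n α ω b D L M C h₀ v v' G F r) (θ h t : ℝ)
    (hh : h₀ < h) : HasDerivAt (fun x => D * r θ x t ^ α * v θ)
      (D * α * v θ * r θ h t ^ (α - 1) * rh α ω b D v G F r θ h t) h :=
  ((((S.hasDerivAt_h θ h t hh).rpow_const (Or.inl (S.pos hh θ t).ne')).const_mul D).mul_const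
    (v θ)).congr_deriv (by ring)

theorem hasDerivAt_X_t (S : PerturbedRadius n α ω b D L M C h₀ v v' G F r) (θ h t : ℝ)
    (hh : h₀ < h) : HasDerivAt (fun τ => D * r θ h τ ^ α * v θ)
      (D * α * v θ * r θ h t ^ (α - 1) * rt α b D v G F r θ h t) t :=
  ((((S.hasDerivAt_t θ h t hh).rpow_const (Or.inl (S.pos hh θ t).ne')).const_mul D).mul_const
    (v θ)).congr_deriv (by ring)

theorem isSymbol_dX (S : PerturbedRadius n α ω b D L M C h₀ v v' G F r)
    (hc : Core α ω D h₀ v G r n m) :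
    IsSymbol (1 - α) h₀ m (α - 1) (fun θ h t => D * α * v θ * r θ h t ^ (α - 1)) :=
  ((S.isSymbol_v m).const_mul S.nonneg (D * α)).mul S.nonneg (S.isSymbol_rpow hc _) (zero_add _)

theorem core_zero (S : PerturbedRadius n α ω b D L M C h₀ v v' G F r) :
    Core α ω D h₀ v G r n 0 := by
  have hne : ∀ z : ℝ × ℝ × ℝ, h₀ < z.2.1 → ω * z.2.1 ≠ 0 := fun z hz =>
    (mul_pos S.ω_pos (S.nonneg.trans_lt hz)).ne'
  refine ⟨⟨3 / 2, ?_, fun θ h t hh => ?_⟩, fun i j hij => ⟨C, ?_, fun θ h t hh => ?_⟩⟩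
  · exact S.continuousOn.div (by fun_prop) hne
  · have h1 := S.ratio_mem θ h t hh
    simp only [Real.rpow_zero, mul_one]
    rw [abs_of_nonneg (by linarith [h1.1])]
    exact h1.2
  · have h1 := contDiff_iterD S.contDiff_G (i := i) (j := j) (k := n - (i + j)) (by omega)
    have h2 : ContinuousOn (fun z : ℝ × ℝ × ℝ => (D * r z.1 z.2.1 z.2.2 ^ α * v z.1, z.2.2))
        {z | h₀ < z.2.1} :=
      ((continuousOn_const.mul (S.continuousOn.rpow_const fun z hz =>
        Or.inl (S.pos hz _ _).ne')).mul (S.continuous_v.comp continuous_fst).continuousOn).prodMk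
        (by fun_prop)
    exact h1.continuous.comp_continuousOn h2
  · simpa using S.abs_iterD_G_le i j (by omega) _ _

theorem core_succ (S : PerturbedRadius n α ω b D L M C h₀ v v' G F r)
    (hc : Core α ω D h₀ v G r n m) (hm : m + 1 ≤ n) : Core α ω D h₀ v G r n (m + 1) := by
  have hz := S.core_zero
  have hα := S.α_pos
  have hα2 := S.α_le
  have hpow : ∀ β : ℝ, IsSymbol (1 - α) h₀ m β (fun _ h _ => h ^ β) := fun β =>
    IsSymbol.rpow_self (by linarith) S.one_le m β
  refine ⟨?_, fun i j hij => ?_⟩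
  · refine IsSymbol.succ_intro S.nonneg hz.1
      (gh := fun θ h t => rh α ω b D v G F r θ h t * (ω⁻¹ * h ^ (-1 : ℝ)) -
        r θ h t ^ (1 : ℝ) * (ω⁻¹ * h ^ (-2 : ℝ)))
      (gt := fun θ h t => rt α b D v G F r θ h t * (ω⁻¹ * h ^ (-1 : ℝ))) ?_ ?_ ?_ ?_
    · intro θ h t hh
      have h1 : 0 < h := S.nonneg.trans_lt hh
      have hω := S.ω_pos
      refine ((S.hasDerivAt_h θ h t hh).div ((hasDerivAt_id' h).const_mul ω)
        (by positivity)).congr_deriv ?_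
      rw [Real.rpow_neg_one, Real.rpow_neg h1.le, Real.rpow_one,
        show (2 : ℝ) = ((2 : ℕ) : ℝ) by norm_num, Real.rpow_natCast]
      field_simp
    · intro θ h t hh
      refine ((S.hasDerivAt_t θ h t hh).div_const (ω * h)).congr_deriv ?_
      rw [Real.rpow_neg_one]
      field_simp
    · refine IsSymbol.mono S.one_le (by linarith : (-1 : ℝ) ≤ 0 - (1 - α)) ?_
      exact ((S.isSymbol_rh hc hm).mul S.nonneg ((hpow _).const_mul S.nonneg _)
        (by norm_num)).sub S.nonneg ((S.isSymbol_rpow hc 1).mul S.nonneg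
          ((hpow _).const_mul S.nonneg _) (by norm_num))
    · refine IsSymbol.mono S.one_le (by linarith : α + -1 ≤ 0) ?_
      exact (S.isSymbol_rt hc hm).mul S.nonneg ((hpow _).const_mul S.nonneg _) rfl
  · have hd := hasFDerivAt_iterD S.contDiff_G (i := i) (j := j) (by omega)
    have h1 := hc.2 (i + 1) j (by omega)
    refine IsSymbol.succ_intro S.nonneg (hz.2 i j (by omega))
      (fun θ h t hh => (hd _).hasDerivAt_comp₂ (S.hasDerivAt_X_h θ h t hh) (hasDerivAt_const h t))
      (fun θ h t hh => (hd _).hasDerivAt_comp₂ (S.hasDerivAt_X_t θ h t hh) (hasDerivAt_id' t))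
      ?_ ?_
    · have h2 := h1.mul S.nonneg ((S.isSymbol_dX hc).mul S.nonneg (S.isSymbol_rh hc hm)
        (add_zero _)) (zero_add _)
      exact (h2.congr S.nonneg fun θ h t _ => by simp).mono S.one_le (by linarith)
    · have h2 := h1.mul S.nonneg ((S.isSymbol_dX hc).mul S.nonneg (S.isSymbol_rt hc hm) rfl)
        (zero_add _)
      exact (h2.mono S.one_le (by linarith)).add S.nonneg
        ((hc.2 i (j + 1) (by omega)).congr S.nonneg fun θ h t _ => by simp)

theorem core (S : PerturbedRadius n α ω b D L M C h₀ v v' G F r) (hm : m ≤ n) :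
    Core α ω D h₀ v G r n m := by
  induction m with
  | zero => exact S.core_zero
  | succ m ih => exact S.core_succ (ih (by omega)) hm

end Core

end PerturbedRadius

theorem continuousOn_const_mul_rpow {h₀ : ℝ} (hh₀ : 0 ≤ h₀) (K β : ℝ) :
    ContinuousOn (fun h : ℝ => K * h ^ β) (Set.Ioi h₀) :=
  continuousOn_const.mul
    (continuousOn_id.rpow_const fun _ hx => Or.inl (hh₀.trans_lt hx).ne')

theorem integral_abs_le_of_abs_le {χ : ℝ → ℝ} (hχ : Continuous χ) {B T : ℝ}
    (hB : ∀ θ, |χ θ| ≤ B) (hT : 0 ≤ T) : ∫ θ in (0 : ℝ)..T, |χ θ| ≤ T * B := by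
  have h1 := intervalIntegral.integral_mono_on (μ := MeasureTheory.volume) hT
    (hχ.abs.intervalIntegrable 0 T) ((continuous_const (y := B)).intervalIntegrable 0 T)
    fun θ _ => hB θ
  simpa using h1

theorem IsSymbol.exists_integral_bound {s h₀ : ℝ} (hh₀ : 0 ≤ h₀) {m : ℕ} {β : ℝ}
    {g : ℝ → ℝ → ℝ → ℝ} (hg : IsSymbol s h₀ m β g) {T : ℝ} (hT : 0 ≤ T) :
    ∃ K, 0 ≤ K ∧ ∀ (χ : ℝ → ℝ) (B : ℝ), Continuous χ → (∀ θ, |χ θ| ≤ B) →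
      WeightedBound s h₀ m (fun h => B * (K * h ^ β))
        (fun _ h t => ∫ θ in (0 : ℝ)..T, χ θ * g θ h t) := by
  obtain ⟨K, hK0, hK⟩ := hg.exists_pos hh₀
  refine ⟨T * K, by positivity, fun χ B hχ hB => ?_⟩
  refine (hK.integral hh₀ (continuousOn_const_mul_rpow hh₀ K β) hχ hT
    (integral_abs_le_of_abs_le hχ hB hT)).congr hh₀ (fun h _ => le_of_eq ?_) fun _ _ _ _ => rfl
  ring

theorem IsSymbol.exists_eval_bound {s h₀ : ℝ} (hh₀ : 0 ≤ h₀) {m : ℕ} {β : ℝ}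
    {g : ℝ → ℝ → ℝ → ℝ} (hg : IsSymbol s h₀ m β g) (θ₀ : ℝ) :
    ∃ K, 0 ≤ K ∧ ∀ c B : ℝ, |c| ≤ B →
      WeightedBound s h₀ m (fun h => B * (K * h ^ β)) (fun _ h t => c * g θ₀ h t) := by
  obtain ⟨K, hK0, hK⟩ := hg.exists_pos hh₀
  refine ⟨K, hK0.le, fun c B hc => (hK.eval_index hh₀ c θ₀).congr hh₀ (fun h hh => ?_)
    fun _ _ _ _ => rfl⟩
  have h1 : 0 ≤ h ^ β := Real.rpow_nonneg (hh₀.trans hh.le) _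
  exact mul_le_mul_of_nonneg_right hc (by positivity)

namespace PerturbedRadius

open ImplicitRadius

variable {n : ℕ} {α ω b D L M C h₀ : ℝ} {v v' : ℝ → ℝ} {G : ℝ → ℝ → ℝ} {F : ℕ → ℝ → ℝ}
  {r : ℝ → ℝ → ℝ → ℝ}

/-- The `h`-derivative of `G(D r^α v, t)`. -/
noncomputable def dG (α ω b D : ℝ) (v : ℝ → ℝ) (G : ℝ → ℝ → ℝ) (F : ℕ → ℝ → ℝ)
    (r : ℝ → ℝ → ℝ → ℝ) (θ h t : ℝ) : ℝ :=
  iterD G 1 0 (D * r θ h t ^ α * v θ) t *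
    (D * α * v θ * r θ h t ^ (α - 1) * rh α ω b D v G F r θ h t)

/-- The part of `dG` coming from `∂r/∂h ≠ ω`. -/
noncomputable def dGCorr (α ω b D : ℝ) (v : ℝ → ℝ) (G : ℝ → ℝ → ℝ) (F : ℕ → ℝ → ℝ)
    (r : ℝ → ℝ → ℝ → ℝ) (θ h t : ℝ) : ℝ :=
  iterD G 1 0 (D * r θ h t ^ α * v θ) t *
    (D * α * v θ * r θ h t ^ (α - 1) * (rh α ω b D v G F r θ h t - ω))

/-- The correction terms coming from `∂r/∂θ ≠ 0` when integrating by parts. -/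
noncomputable def partsCorr (α ω b D : ℝ) (v v' : ℝ → ℝ) (G : ℝ → ℝ → ℝ) (F : ℕ → ℝ → ℝ)
    (r : ℝ → ℝ → ℝ → ℝ) (θ h t : ℝ) : ℝ :=
  α * ω * (r θ h t ^ (-2 : ℝ) * rθ α b D v v' G F r θ h t * iterD G 0 0 (D * r θ h t ^ α * v θ) t)
    - ω * α * (iterD G 1 0 (D * r θ h t ^ α * v θ) t *
      (D * α * v θ * r θ h t ^ (α - 1) * (r θ h t ^ (-1 : ℝ) * rθ α b D v v' G F r θ h t)))

/-- The boundary term of the integration by parts. -/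
noncomputable def bdry (α ω D : ℝ) (v : ℝ → ℝ) (G : ℝ → ℝ → ℝ)
    (r : ℝ → ℝ → ℝ → ℝ) (θ h t : ℝ) : ℝ :=
  α * ω * (r θ h t ^ (-1 : ℝ) * iterD G 0 0 (D * r θ h t ^ α * v θ) t)

section

variable {m : ℕ}

theorem isSymbol_dG (S : PerturbedRadius n α ω b D L M C h₀ v v' G F r) (hm : m + 1 ≤ n) :
    IsSymbol (1 - α) h₀ m (α - 1) (dG α ω b D v G F r) := by
  have hc := S.core (m := m) (by omega)
  exact (hc.2 1 0 (by omega)).mul S.nonneg ((S.isSymbol_dX hc).mul S.nonneg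
    (S.isSymbol_rh hc hm) (add_zero _)) (zero_add _)

theorem isSymbol_dGCorr (S : PerturbedRadius n α ω b D L M C h₀ v v' G F r) (hm : m + 1 ≤ n) :
    IsSymbol (1 - α) h₀ m (-1) (dGCorr α ω b D v G F r) := by
  have hc := S.core (m := m) (by omega)
  have hα := S.α_le
  exact IsSymbol.mono S.one_le (by linarith : α - 1 + (α - 1) ≤ -1)
    ((hc.2 1 0 (by omega)).mul S.nonneg ((S.isSymbol_dX hc).mul S.nonneg
      (S.isSymbol_rh_sub hc hm) rfl) (zero_add _))

theorem isSymbol_partsCorr (S : PerturbedRadius n α ω b D L M C h₀ v v' G F r) (hm : m + 1 ≤ n) :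
    IsSymbol (1 - α) h₀ m (-1) (partsCorr α ω b D v v' G F r) := by
  have hc := S.core (m := m) (by omega)
  have hα := S.α_le
  have h1 := ((S.isSymbol_rpow hc (-2)).mul S.nonneg (S.isSymbol_rθ hc hm) rfl).mul S.nonneg
    (hc.2 0 0 (by omega)) (add_zero _)
  have h2 := (hc.2 1 0 (by omega)).mul S.nonneg ((S.isSymbol_dX hc).mul S.nonneg
    ((S.isSymbol_rpow hc (-1)).mul S.nonneg (S.isSymbol_rθ hc hm) rfl) rfl) (zero_add _)
  exact ((h1.mono S.one_le (by linarith)).const_mul S.nonneg (α * ω)).sub S.nonneg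
    ((h2.mono S.one_le (by linarith)).const_mul S.nonneg (ω * α))

theorem isSymbol_bdry (S : PerturbedRadius n α ω b D L M C h₀ v v' G F r) (hm : m + 1 ≤ n) :
    IsSymbol (1 - α) h₀ m (-1) (bdry α ω D v G r) := by
  have hc := S.core (m := m) (by omega)
  exact ((S.isSymbol_rpow hc (-1)).mul S.nonneg (hc.2 0 0 (by omega)) (add_zero _)).const_mul
    S.nonneg (α * ω)

end

theorem hasDerivAt_bdry (S : PerturbedRadius (n + 1) α ω b D L M C h₀ v v' G F r) {h : ℝ}
    (hh : h₀ < h) (t θ : ℝ) : HasDerivAt (fun θ => bdry α ω D v G r θ h t)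
      (α * ω * (-1 * r θ h t ^ (-2 : ℝ) * rθ α b D v v' G F r θ h t *
        iterD G 0 0 (D * r θ h t ^ α * v θ) t + r θ h t ^ (-1 : ℝ) *
        (iterD G 1 0 (D * r θ h t ^ α * v θ) t * (D * α * v θ * r θ h t ^ (α - 1) *
          rθ α b D v v' G F r θ h t + D * r θ h t ^ α * v' θ)))) θ := by
  have hr := S.hasDerivAt_θ θ h t hh
  have hne := (S.pos hh θ t).ne'
  have h1 := hr.rpow_const (p := -1) (Or.inl hne)
  have h2 := ((hr.rpow_const (p := α) (Or.inl hne)).const_mul D).mul (S.hasDerivAt_v θ)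
  have h3 := (hasFDerivAt_iterD S.contDiff_G (i := 0) (j := 0) (by omega)
    (D * r θ h t ^ α * v θ, t)).hasDerivAt_comp₂ h2 (hasDerivAt_const θ t)
  refine ((h1.mul h3).const_mul (α * ω)).congr_deriv ?_
  norm_num
  left
  ring

/-- Integration by parts in `θ` of the part of `dG` localized by a multiplier `ψ`. -/
theorem integral_dG_eq (S : PerturbedRadius (n + 1) α ω b D L M C h₀ v v' G F r)
    {ψ ψ' : ℝ → ℝ} (hψ : ∀ θ, HasDerivAt ψ (ψ' θ) θ) (hψ'c : Continuous ψ') (T : ℝ) {h : ℝ}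
    (hh : h₀ < h) (t : ℝ) :
    ∫ θ in (0 : ℝ)..T, dG α ω b D v G F r θ h t =
      (∫ θ in (0 : ℝ)..T, (1 - v' θ * ψ θ) * dG α ω b D v G F r θ h t) +
      ((∫ θ in (0 : ℝ)..T, v' θ * ψ θ * dGCorr α ω b D v G F r θ h t) +
      ((∫ θ in (0 : ℝ)..T, v θ * ψ θ * partsCorr α ω b D v v' G F r θ h t) +
      ((∫ θ in (0 : ℝ)..T, -(v' θ * ψ θ + v θ * ψ' θ) * bdry α ω D v G r θ h t) +
      (v T * ψ T * bdry α ω D v G r T h t + -(v 0 * ψ 0) * bdry α ω D v G r 0 h t)))) := by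
  obtain ⟨K₁, h₁⟩ := S.isSymbol_dG (m := 0) (by omega)
  obtain ⟨K₂, h₂⟩ := S.isSymbol_dGCorr (m := 0) (by omega)
  obtain ⟨K₃, h₃⟩ := S.isSymbol_partsCorr (m := 0) (by omega)
  obtain ⟨K₄, h₄⟩ := S.isSymbol_bdry (m := 0) (by omega)
  have c₁ := h₁.base.continuous_index hh t
  have c₂ := h₂.base.continuous_index hh t
  have c₃ := h₃.base.continuous_index hh t
  have c₄ := h₄.base.continuous_index hh t
  have cv := S.continuous_v
  have cv' := S.continuous_v'
  have cψ : Continuous ψ := continuous_iff_continuousAt.2 fun θ => (hψ θ).continuousAt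
  have hparts : ∀ θ, HasDerivAt (fun θ => v θ * ψ θ * bdry α ω D v G r θ h t)
      (dG α ω b D v G F r θ h t - (1 - v' θ * ψ θ) * dG α ω b D v G F r θ h t -
        v' θ * ψ θ * dGCorr α ω b D v G F r θ h t -
        v θ * ψ θ * partsCorr α ω b D v v' G F r θ h t -
        -(v' θ * ψ θ + v θ * ψ' θ) * bdry α ω D v G r θ h t) θ := fun θ => by
    refine (((S.hasDerivAt_v θ).mul (hψ θ)).mul (S.hasDerivAt_bdry hh t θ)).congr_deriv ?_
    have hpos := S.pos hh θ t
    have e1 : r θ h t ^ α = r θ h t * r θ h t ^ (α - 1) := by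
      nth_rewrite 2 [← Real.rpow_one (r θ h t)]
      rw [← Real.rpow_add hpos]
      ring_nf
    have e2 : r θ h t ^ (-1 : ℝ) * r θ h t = 1 := by
      rw [Real.rpow_neg_one, inv_mul_cancel₀ hpos.ne']
    simp only [dG, dGCorr, partsCorr, Pi.mul_apply]
    set g₁ := iterD G 1 0 (D * r θ h t ^ α * v θ) t
    set g₀ := iterD G 0 0 (D * r θ h t ^ α * v θ) t
    have e3 : r θ h t ^ (-1 : ℝ) * (g₁ * (D * α * v θ * r θ h t ^ (α - 1) *
        rθ α b D v v' G F r θ h t + D * r θ h t ^ α * v' θ)) =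
        g₁ * (r θ h t ^ (-1 : ℝ) * (D * α * v θ * r θ h t ^ (α - 1) *
        rθ α b D v v' G F r θ h t)) + g₁ * D * r θ h t ^ (α - 1) * v' θ := by
      rw [e1]
      linear_combination g₁ * D * r θ h t ^ (α - 1) * v' θ * e2
    rw [e3]
    ring
  have hint : ∀ χ : ℝ → ℝ, Continuous χ → IntervalIntegrable χ MeasureTheory.volume 0 T :=
    fun _ h => h.intervalIntegrable 0 T
  have i₁ := hint (fun θ => dG α ω b D v G F r θ h t) c₁
  have i₂ := hint (fun θ => (1 - v' θ * ψ θ) * dG α ω b D v G F r θ h t)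
    ((continuous_const.sub (cv'.mul cψ)).mul c₁)
  have i₃ := hint (fun θ => v' θ * ψ θ * dGCorr α ω b D v G F r θ h t) ((cv'.mul cψ).mul c₂)
  have i₄ := hint (fun θ => v θ * ψ θ * partsCorr α ω b D v v' G F r θ h t)
    ((cv.mul cψ).mul c₃)
  have i₅ := hint (fun θ => -(v' θ * ψ θ + v θ * ψ' θ) * bdry α ω D v G r θ h t)
    (((cv'.mul cψ).add (cv.mul hψ'c)).neg.mul c₄)
  have hftc := intervalIntegral.integral_eq_sub_of_hasDerivAt (a := 0) (b := T)
    (fun θ _ => hparts θ) ((((i₁.sub i₂).sub i₃).sub i₄).sub i₅)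
  rw [intervalIntegral.integral_sub (((i₁.sub i₂).sub i₃).sub i₄) i₅,
    intervalIntegral.integral_sub ((i₁.sub i₂).sub i₃) i₄,
    intervalIntegral.integral_sub (i₁.sub i₂) i₃, intervalIntegral.integral_sub i₁ i₂] at hftc
  linarith

/-- The `θ`-integral of `dG` decays: a cutoff of size `ε` near `v' = 0` costs `√ε`, and integrating
by parts away from it gains `h^(-1)`. -/
theorem exists_integral_dG_bound (S : PerturbedRadius (n + 1) α ω b D L M C h₀ v v' G F r)
    {p q : ℝ} {w u : ℝ → ℝ} {c E : ℝ} (O : EnergyOrbit p q v v' w u M c E) (hp : 1 ≤ p)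
    (hq : 1 ≤ q) {T : ℝ} (hT : 0 ≤ T) : ∃ K, 0 ≤ K ∧ ∀ ε : ℝ, 0 < ε → ε ≤ 1 →
      WeightedBound (1 - α) h₀ n (fun h => K * (√ε * h ^ (α - 1) + ε⁻¹ ^ 2 * h ^ (-1 : ℝ)))
        (fun _ h t => ∫ θ in (0 : ℝ)..T, dG α ω b D v G F r θ h t) := by
  obtain ⟨K₀, hK₀, hcut⟩ := O.exists_integral_cutoff_le hp hq hT
  obtain ⟨K₁, hK₁, b₁⟩ := (S.isSymbol_dG (m := n) le_rfl).exists_pos S.nonneg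
  obtain ⟨K₂, hK₂, b₂⟩ := (S.isSymbol_dGCorr (m := n) le_rfl).exists_integral_bound S.nonneg hT
  obtain ⟨K₃, hK₃, b₃⟩ := (S.isSymbol_partsCorr (m := n) le_rfl).exists_integral_bound S.nonneg hT
  obtain ⟨K₄, hK₄, b₄⟩ := (S.isSymbol_bdry (m := n) le_rfl).exists_integral_bound S.nonneg hT
  obtain ⟨K₅, hK₅, b₅⟩ := (S.isSymbol_bdry (m := n) le_rfl).exists_eval_bound S.nonneg T
  obtain ⟨K₆, hK₆, b₆⟩ := (S.isSymbol_bdry (m := n) le_rfl).exists_eval_bound S.nonneg 0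
  have hM := O.one_le_M
  set B := (2 + q) * M ^ 4 with hB
  have hB0 : 0 ≤ B := by positivity
  refine ⟨K₀ * K₁ + B * (K₂ + K₃ + K₄ + K₅ + K₆), by positivity, fun ε hε hε1 => ?_⟩
  set ψ : ℝ → ℝ := fun θ => w θ / (ε + v' θ * w θ) with hψ
  set ψ' : ℝ → ℝ := fun θ =>
    (-u θ * (ε + v' θ * w θ) + w θ * (q * u θ * v' θ)) / (ε + v' θ * w θ) ^ 2 with hψ'
  have dψ : ∀ θ, HasDerivAt ψ (ψ' θ) θ := O.hasDerivAt_multiplier hε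
  have cψ' : Continuous ψ' := O.continuous_deriv_multiplier hε
  have cψ : Continuous ψ := continuous_iff_continuousAt.2 fun θ => (dψ θ).continuousAt
  have cv := O.continuous_v
  have cv' := O.continuous_v'
  have hmul : ∀ {x y A A' : ℝ}, |x| ≤ A → |y| ≤ A' → |x * y| ≤ A * A' := fun hx hy => by
    rw [abs_mul]
    exact mul_le_mul hx hy (abs_nonneg _) ((abs_nonneg _).trans hx)
  have hψb : M * (M / ε) ≤ M ^ 4 * ε⁻¹ ^ 2 := by
    have h1 : 1 ≤ ε⁻¹ := (one_le_inv₀ hε).2 hε1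
    have h2 : M * (M / ε) = M ^ 2 * ε⁻¹ := by
      field_simp
    rw [h2]
    exact mul_le_mul (pow_le_pow_right₀ hM (by norm_num)) (le_self_pow₀ h1 (by norm_num))
      (by positivity) (by positivity)
  have hψB : M * (M / ε) ≤ B * ε⁻¹ ^ 2 := hψb.trans <| by
    have : 0 ≤ M ^ 4 * ε⁻¹ ^ 2 := by positivity
    rw [hB]
    nlinarith
  have m₁ : ∀ θ, |v' θ * ψ θ| ≤ B * ε⁻¹ ^ 2 := fun θ =>
    (hmul (O.abs_v'_le θ) (O.abs_multiplier_le hε θ)).trans hψB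
  have m₂ : ∀ θ, |v θ * ψ θ| ≤ B * ε⁻¹ ^ 2 := fun θ =>
    (hmul (O.abs_v_le θ) (O.abs_multiplier_le hε θ)).trans hψB
  have m₃ : ∀ θ, |-(v' θ * ψ θ + v θ * ψ' θ)| ≤ B * ε⁻¹ ^ 2 := fun θ => by
    rw [abs_neg]
    have h1 := (hmul (O.abs_v'_le θ) (O.abs_multiplier_le hε θ)).trans hψb
    have h2 := hmul (O.abs_v_le θ) (O.abs_deriv_multiplier_le hq hε hε1 θ)
    refine ((abs_add_le _ _).trans (add_le_add h1 h2)).trans (le_of_eq ?_)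
    rw [hB]
    field_simp
    ring
  have m₄ : |-(v 0 * ψ 0)| ≤ B * ε⁻¹ ^ 2 := by
    rw [abs_neg]
    exact m₂ 0
  have hκ : ∀ θ, 1 - v' θ * ψ θ = ε / (ε + v' θ * w θ) := fun θ => by
    have := (O.add_mul_pos hε θ).ne'
    simp only [hψ]
    field_simp
    ring
  have cκ : Continuous fun θ => 1 - v' θ * ψ θ := continuous_const.sub (cv'.mul cψ)
  have a₁ := b₁.integral S.nonneg (continuousOn_const_mul_rpow S.nonneg K₁ _) cκ hT
    (A := K₀ * √ε) (by simpa only [hκ] using hcut ε hε hε1)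
  have a₂ := b₂ (fun θ => v' θ * ψ θ) _ (cv'.mul cψ) m₁
  have a₃ := b₃ (fun θ => v θ * ψ θ) _ (cv.mul cψ) m₂
  have a₄ := b₄ (fun θ => -(v' θ * ψ θ + v θ * ψ' θ)) _
    ((cv'.mul cψ).add (cv.mul cψ')).neg m₃
  have a₅ := b₅ (v T * ψ T) _ (m₂ T)
  have a₆ := b₆ (-(v 0 * ψ 0)) _ m₄
  refine (a₁.add S.nonneg (a₂.add S.nonneg (a₃.add S.nonneg (a₄.add S.nonneg
    (a₅.add S.nonneg a₆))))).congr S.nonneg (fun h hh => ?_)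
    fun _ h t hh => S.integral_dG_eq dψ cψ' T hh t
  have h0 : 0 ≤ h := S.nonneg.trans hh.le
  have p₁ : 0 ≤ √ε * h ^ (α - 1) := mul_nonneg (Real.sqrt_nonneg _) (Real.rpow_nonneg h0 _)
  have p₂ : 0 ≤ ε⁻¹ ^ 2 * h ^ (-1 : ℝ) := mul_nonneg (by positivity) (Real.rpow_nonneg h0 _)
  have p₃ : 0 ≤ B * (K₂ + K₃ + K₄ + K₅ + K₆) * (√ε * h ^ (α - 1)) :=
    mul_nonneg (by positivity) p₁
  have p₄ : 0 ≤ K₀ * K₁ * (ε⁻¹ ^ 2 * h ^ (-1 : ℝ)) := mul_nonneg (by positivity) p₂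
  nlinarith [p₃, p₄]

end PerturbedRadius

namespace PerturbedRadius

open ImplicitRadius

variable {n : ℕ} {α ω b D L M C h₀ : ℝ} {v v' : ℝ → ℝ} {G : ℝ → ℝ → ℝ} {F : ℕ → ℝ → ℝ}
  {r : ℝ → ℝ → ℝ → ℝ}

/-- The remainder of `r` beyond its leading part `ω h + b D (ω h)^α v F₀`. -/
noncomputable def remainder (α ω b D : ℝ) (v : ℝ → ℝ) (G : ℝ → ℝ → ℝ) (F : ℕ → ℝ → ℝ)
    (r : ℝ → ℝ → ℝ → ℝ) (θ h t : ℝ) : ℝ :=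
  -b * iterD G 0 0 (D * r θ h t ^ α * v θ) t +
    b * (F 0 t * (D * r θ h t ^ α * v θ - D * (ω * h) ^ α * v θ))

/-- The `h`-derivative of `F₀ (D r^α v - D (ω h)^α v)`. -/
noncomputable def dShift (α ω b D : ℝ) (v : ℝ → ℝ) (G : ℝ → ℝ → ℝ) (F : ℕ → ℝ → ℝ)
    (r : ℝ → ℝ → ℝ → ℝ) (θ h t : ℝ) : ℝ :=
  F 0 t * (D * α * v θ * r θ h t ^ (α - 1) * rh α ω b D v G F r θ h t -
    D * α * v θ * (ω * h) ^ (α - 1) * ω)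

theorem remainder_eq (S : PerturbedRadius n α ω b D L M C h₀ v v' G F r) (θ h t : ℝ) (hh : h₀ < h) :
    remainder α ω b D v G F r θ h t =
      r θ h t - ω * h - b * (D * (ω * h) ^ α * v θ) * F 0 t := by
  have h1 := S.eq θ h t hh
  simp only [remainder, iterD, iteratedDeriv_zero]
  linarith

section

variable {m : ℕ}

theorem isSymbol_ratio_sub (S : PerturbedRadius n α ω b D L M C h₀ v v' G F r) (hm : m ≤ n) :
    IsSymbol (1 - α) h₀ m (α - 1) (fun θ h t => r θ h t / (ω * h) - 1) := by
  have hc := S.core (m := m) hm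
  have h1 := ((hc.2 0 0 (by omega)).mono S.one_le S.α_pos.le).sub S.nonneg
    ((S.isSymbol_X hc).mul S.nonneg (S.isSymbol_F (m := m) (k := 0) (by omega)) (add_zero α))
  refine (((IsSymbol.rpow_self (s := 1 - α) (by linarith [S.α_pos]) S.one_le m (-1)).const_mul
    S.nonneg (-b / ω)).mul S.nonneg h1 (by ring)).congr S.nonneg fun θ h t hh => ?_
  have h2 := S.eq θ h t hh
  have h3 : 0 < h := S.nonneg.trans_lt hh
  have h4 := S.ω_pos
  have h5 : r θ h t = ω * h - b * (G (D * r θ h t ^ α * v θ) t -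
      D * r θ h t ^ α * v θ * F 0 t) := by linarith
  simp only [iterD, iteratedDeriv_zero]
  rw [Real.rpow_neg_one, div_sub_one (by positivity)]
  nth_rewrite 1 [h5]
  field_simp
  ring

theorem rpow_sub_rpow_eq (S : PerturbedRadius n α ω b D L M C h₀ v v' G F r) (β θ h t : ℝ)
    (hh : h₀ < h) : r θ h t ^ β - (ω * h) ^ β =
      ω ^ β * (h ^ β * ((r θ h t / (ω * h)) ^ β - 1)) := by
  have h3 : 0 < h := S.nonneg.trans_lt hh
  have h4 := S.ω_pos
  have h5 := S.pos hh θ t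
  rw [mul_sub, mul_sub, ← mul_assoc, ← Real.mul_rpow h4.le h3.le, mul_one,
    ← Real.mul_rpow (by positivity) (by positivity), ← Real.mul_rpow h4.le h3.le,
    mul_div_cancel₀ _ (by positivity)]

theorem isSymbol_rpow_sub_rpow (S : PerturbedRadius n α ω b D L M C h₀ v v' G F r) (hm : m ≤ n)
    (β : ℝ) : IsSymbol (1 - α) h₀ m (β + (α - 1)) (fun θ h t => r θ h t ^ β - (ω * h) ^ β) :=
  (((IsSymbol.rpow_self (s := 1 - α) (by linarith [S.α_pos]) S.one_le m β).mul S.nonneg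
    ((S.core (m := m) hm).1.rpow_sub_one S.nonneg (S.isSymbol_ratio_sub hm) S.ratio_mem β)
    rfl).const_mul S.nonneg (ω ^ β)).congr S.nonneg (S.rpow_sub_rpow_eq β)

theorem isSymbol_remainder (S : PerturbedRadius n α ω b D L M C h₀ v v' G F r) (hm : m ≤ n) :
    IsSymbol (1 - α) h₀ m 0 (remainder α ω b D v G F r) := by
  have hα := S.α_le
  have h1 := (S.core (m := m) hm).2 0 0 (by omega)
  have h2 := (S.isSymbol_F (m := m) (k := 0) (by omega)).mul S.nonneg
    (((S.isSymbol_v m).const_mul S.nonneg D).mul S.nonneg (S.isSymbol_rpow_sub_rpow hm α) rfl) rfl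
  refine ((h1.const_mul S.nonneg (-b)).add S.nonneg
    ((h2.mono S.one_le (by linarith)).const_mul S.nonneg b)).congr S.nonneg fun θ h t _ => ?_
  rw [remainder]
  ring

theorem isSymbol_dShift (S : PerturbedRadius n α ω b D L M C h₀ v v' G F r) (hm : m + 1 ≤ n) :
    IsSymbol (1 - α) h₀ m (-1) (dShift α ω b D v G F r) := by
  have hα := S.α_le
  have hc := S.core (m := m) (by omega)
  have h1 := (S.isSymbol_dX hc).mul S.nonneg (S.isSymbol_rh_sub hc hm) rfl
  have h2 := ((S.isSymbol_v m).const_mul S.nonneg (D * α * ω)).mul S.nonneg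
    (S.isSymbol_rpow_sub_rpow (m := m) (by omega) (α - 1)) (zero_add _)
  refine (((S.isSymbol_F (m := m) (k := 0) (by omega)).mul S.nonneg (h1.add S.nonneg h2)
    (zero_add _)).mono S.one_le (by linarith)).congr S.nonneg fun θ h t _ => ?_
  rw [dShift]
  ring

end

theorem hasDerivAt_remainder (S : PerturbedRadius (n + 1) α ω b D L M C h₀ v v' G F r)
    (θ h t : ℝ) (hh : h₀ < h) : HasDerivAt (fun x => remainder α ω b D v G F r θ x t)
      (-b * dG α ω b D v G F r θ h t + b * dShift α ω b D v G F r θ h t) h := by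
  have hX := S.hasDerivAt_X_h θ h t hh
  have h1 := (hasFDerivAt_iterD S.contDiff_G (i := 0) (j := 0) (by omega)
    (D * r θ h t ^ α * v θ, t)).hasDerivAt_comp₂ hX (hasDerivAt_const h t)
  have h2 : ω * h ≠ 0 := (mul_pos S.ω_pos (S.nonneg.trans_lt hh)).ne'
  have h3 := (((((hasDerivAt_id' h).const_mul ω).rpow_const (p := α) (Or.inl h2)).const_mul
    D).mul_const (v θ))
  refine ((h1.const_mul (-b)).add (((hX.sub h3).const_mul (F 0 t)).const_mul b)).congr_deriv ?_
  simp only [dG, dShift]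
  ring

/-- Weighted bounds for the derivatives of the `θ`-average of the remainder. -/
theorem exists_average_bound (S : PerturbedRadius (n + 1) α ω b D L M C h₀ v v' G F r)
    {p q : ℝ} {w u : ℝ → ℝ} {c E : ℝ} (O : EnergyOrbit p q v v' w u M c E) (hp : 1 ≤ p)
    (hq : 1 ≤ q) {T : ℝ} (hT : 0 ≤ T) (A : ℝ) {N : ℝ → ℝ → ℝ}
    (hN : ∀ h t, h₀ < h → N h t = A * ∫ θ in (0 : ℝ)..T, remainder α ω b D v G F r θ h t) :
    ∃ K, 0 ≤ K ∧ ∀ i j : ℕ, i + j ≤ n + 1 → ∀ t h : ℝ, h₀ < h →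
      |iterD N i j h t| ≤ K * (h ^ (-(i : ℝ)) + h ^ (-(α / 10) - (i : ℝ) * (1 - α))) := by
  have hα := S.α_pos
  have hα2 := S.α_le
  obtain ⟨K₁, hK₁, b₁⟩ := S.exists_integral_dG_bound O hp hq hT
  obtain ⟨K₂, hK₂, b₂⟩ := (S.isSymbol_dShift (m := n) le_rfl).exists_integral_bound S.nonneg hT
  obtain ⟨K₃, hK₃, b₃⟩ := (S.isSymbol_remainder (m := n + 1) le_rfl).exists_integral_bound
    S.nonneg hT
  obtain ⟨K₄, hdP⟩ := (((S.isSymbol_dG (m := 0) (by omega)).const_mul S.nonneg (-b)).add S.nonneg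
    (((S.isSymbol_dShift (m := 0) (by omega)).mono S.one_le
      (by linarith : -1 ≤ α - 1)).const_mul S.nonneg b))
  have hg : WeightedBound (1 - α) h₀ (n + 1) (fun h => |A| * (K₃ * h ^ (0 : ℝ)))
      (fun _ h t => N h t) :=
    (b₃ (fun _ => A) |A| continuous_const fun _ => le_rfl).congr S.nonneg (fun _ _ => le_rfl)
      fun _ h t hh => by rw [hN h t hh, intervalIntegral.integral_const_mul]
  set gh : ℝ → ℝ → ℝ → ℝ := fun _ h t =>
    A * -b * (∫ θ in (0 : ℝ)..T, dG α ω b D v G F r θ h t) +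
      ∫ θ in (0 : ℝ)..T, A * b * dShift α ω b D v G F r θ h t with hgh
  have hbd : ∀ ε : ℝ, 0 < ε → ε ≤ 1 → WeightedBound (1 - α) h₀ n
      (fun h => |A * b| * (K₁ * (√ε * h ^ (α - 1) + ε⁻¹ ^ 2 * h ^ (-1 : ℝ))) +
        |A * b| * (K₂ * h ^ (-1 : ℝ))) gh := fun ε hε hε1 =>
    (((b₁ ε hε hε1).eval_index S.nonneg (A * -b) 0).add S.nonneg
      (b₂ (fun _ => A * b) |A * b| continuous_const fun _ => le_rfl)).congr S.nonneg
        (fun h _ => by simp) fun _ _ _ _ => rfl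
  have hd : ∀ θ h t, h₀ < h → HasDerivAt (fun x => N x t) (gh θ h t) h := fun θ h t hh => by
    have h1 := hasDerivAt_integral_mul (continuousOn_const_mul_rpow S.nonneg K₄ (α - 1))
      (S.isSymbol_remainder (m := 0) (by omega)).choose_spec.base hdP.base
      S.hasDerivAt_remainder (continuous_const (y := A)) T hh t
    refine (h1.congr_of_eventuallyEq ?_).congr_deriv ?_
    · filter_upwards [lt_mem_nhds hh] with x hx
      rw [hN x t hx, intervalIntegral.integral_const_mul]
    · have c₁ := (S.isSymbol_dG (m := 0) (by omega)).choose_spec.base.continuous_index hh t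
      have c₂ := (S.isSymbol_dShift (m := 0) (by omega)).choose_spec.base.continuous_index hh t
      simp only [hgh]
      rw [← intervalIntegral.integral_const_mul, ← intervalIntegral.integral_add
        ((c₁.const_mul _).intervalIntegrable 0 T) ((c₂.const_mul _).intervalIntegrable 0 T)]
      refine intervalIntegral.integral_congr fun θ _ => ?_
      ring
  refine ⟨|A| * K₃ + |A * b| * (2 * K₁ + K₂), by positivity, fun i j hij t h hh => ?_⟩
  have h1 : 1 ≤ h := S.one_le.trans hh.le
  have h0 : 0 < h := zero_lt_one.trans_le h1
  have hs : ∀ x : ℝ, 0 ≤ h ^ x := fun x => Real.rpow_nonneg h0.le x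
  rcases i with _ | i
  · refine (hg.abs_iterD_le hij 0 hh t).trans ?_
    have h2 := hs (-(α / 10))
    have h3 : 0 ≤ |A| * K₃ := by positivity
    have h4 : 0 ≤ |A * b| * (2 * K₁ + K₂) := by positivity
    simp only [pow_zero, one_mul, Nat.cast_zero, neg_zero, Real.rpow_zero, zero_mul, sub_zero,
      mul_one]
    nlinarith [mul_nonneg h3 h2, mul_nonneg h4 h2]
  · have hε : 0 < h ^ (-(α / 5)) := Real.rpow_pos_of_pos h0 _
    have hε1 : h ^ (-(α / 5)) ≤ 1 := Real.rpow_le_one_of_one_le_of_nonpos h1 (by linarith)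
    have hV : ContinuousOn (fun h : ℝ => |A * b| * (K₁ * (√1 * h ^ (α - 1) +
        1⁻¹ ^ 2 * h ^ (-1 : ℝ))) + |A * b| * (K₂ * h ^ (-1 : ℝ))) (Set.Ioi h₀) := by
      have := continuousOn_const_mul_rpow S.nonneg
      exact (continuousOn_const.mul (continuousOn_const.mul ((this _ _).add (this _ _)))).add
        (continuousOn_const.mul (this _ _))
    have h2 := hg.iterD_succ_left hV (hbd 1 one_pos le_rfl) hd (i := i) (j := j) (by omega) 0 hh t
    rw [h2]
    refine ((hbd _ hε hε1).abs_iterD_le (by omega) 0 hh t).trans ?_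
    have e1 : √(h ^ (-(α / 5))) = h ^ (-(α / 10)) := by
      rw [Real.sqrt_eq_rpow, ← Real.rpow_mul h0.le]
      ring_nf
    have e2 : (h ^ (-(α / 5)))⁻¹ ^ 2 = h ^ (2 * α / 5) := by
      rw [← Real.rpow_neg h0.le, ← Real.rpow_natCast, ← Real.rpow_mul h0.le]
      ring_nf
    have e3 : (h ^ (-(1 - α))) ^ i = h ^ (-(1 - α) * i) := by
      rw [Real.rpow_mul h0.le, Real.rpow_natCast]
    have e4 : h ^ (-(1 - α) * i) * h ^ (-(α / 10) + (α - 1)) =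
        h ^ (-(α / 10) - ((i + 1 : ℕ) : ℝ) * (1 - α)) := by
      rw [← Real.rpow_add h0]
      push_cast
      ring_nf
    have e5 : h ^ (2 * α / 5) * h ^ (-1 : ℝ) ≤ h ^ (-(α / 10) + (α - 1)) := by
      rw [← Real.rpow_add h0]
      exact Real.rpow_le_rpow_of_exponent_le h1 (by linarith)
    have e6 : h ^ (-1 : ℝ) ≤ h ^ (-(α / 10) + (α - 1)) :=
      Real.rpow_le_rpow_of_exponent_le h1 (by linarith)
    rw [e1, e2, e3, ← Real.rpow_add h0]
    have e7 : |A * b| * (K₁ * (h ^ (-(α / 10) + (α - 1)) + h ^ (2 * α / 5) * h ^ (-1 : ℝ))) +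
        |A * b| * (K₂ * h ^ (-1 : ℝ)) ≤
        |A * b| * (2 * K₁ + K₂) * h ^ (-(α / 10) + (α - 1)) := by
      have := mul_le_mul_of_nonneg_left e5 (by positivity : 0 ≤ |A * b| * K₁)
      have := mul_le_mul_of_nonneg_left e6 (by positivity : 0 ≤ |A * b| * K₂)
      linarith
    refine (mul_le_mul_of_nonneg_left e7 (hs _)).trans ?_
    rw [mul_left_comm, e4]
    have h3 : 0 ≤ |A| * K₃ := by positivity
    have h4 : 0 ≤ |A * b| * (2 * K₁ + K₂) := by positivity
    have h5 := mul_nonneg h3 (hs (-(α / 10) - ((i + 1 : ℕ) : ℝ) * (1 - α)))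
    have h6 := mul_nonneg (add_nonneg h3 h4) (hs (-((i + 1 : ℕ) : ℝ)))
    linarith

end PerturbedRadius

theorem pip_pos {p : ℝ} (hp : 2 ≤ p) : 0 < pip p := by
  have h1 : 0 < Real.pi / p := div_pos Real.pi_pos (by linarith)
  have h2 : Real.pi / p < Real.pi := div_lt_self Real.pi_pos (by linarith)
  have h3 := Real.sin_pos_of_pos_of_lt_pi h1 h2
  have h4 : 0 < (p - 1) ^ (1 / p) := Real.rpow_pos_of_pos (by linarith) _
  have := Real.pi_pos
  unfold pip
  positivity

theorem Function.Periodic.iteratedDeriv {f : ℝ → ℝ} {T : ℝ} (hf : Function.Periodic f T) (k : ℕ) :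
    Function.Periodic (iteratedDeriv k f) T := fun t => by
  have h1 : (fun x => f (T + x)) = f := funext fun x => by rw [add_comm, hf]
  rw [add_comm, ← congrFun (iteratedDeriv_comp_const_add k f T) t, h1]

theorem Function.Periodic.exists_abs_le {f : ℝ → ℝ} {T : ℝ} (hf : Function.Periodic f T)
    (hT : T ≠ 0) (hc : Continuous f) : ∃ K, ∀ t, |f t| ≤ K := by
  obtain ⟨K, hK⟩ := (hf.isBounded_of_continuous hT hc).exists_norm_le
  exact ⟨K, fun t => hK _ ⟨t, rfl⟩⟩

/-- An a priori localized solution `r` of the implicit equation is a `PerturbedRadius` for large `h`. -/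
theorem exists_perturbedRadius {n : ℕ} {α ω b D M C h₁ : ℝ} {v v' : ℝ → ℝ} {G : ℝ → ℝ → ℝ}
    {F : ℕ → ℝ → ℝ} {r : ℝ → ℝ → ℝ → ℝ} (hα : 0 < α) (hα2 : α ≤ 1 / 2) (hω : 0 < ω) (hD : 0 < D)
    (hv : ∀ θ, HasDerivAt v (v' θ) θ) (hvM : ∀ θ, |v θ| ≤ M) (hv'c : Continuous v')
    (hv'M : ∀ θ, |v' θ| ≤ M) (hG : ContDiff ℝ (n + 1 : ℕ) (fun z : ℝ × ℝ => G z.1 z.2))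
    (hGC : ∀ i j : ℕ, i + j ≤ n + 1 → ∀ x t : ℝ, |iterD G i j x t| ≤ C)
    (hF : ∀ k, k < n + 1 + 1 → ∀ t, HasDerivAt (F k) (F (k + 1) t) t)
    (hFc : ∀ k, k ≤ n + 1 + 1 → Continuous (F k))
    (hFb : ∀ k, k ≤ n + 1 + 1 → ∃ K, ∀ t, |F k t| ≤ K)
    (hmem : ∀ θ h t, h₁ ≤ h → r θ h t ∈ Set.Icc (ω * h / 2) (3 * (ω * h) / 2))
    (heq : ∀ θ h t, h₁ ≤ h → r θ h t +
      b * (G (D * r θ h t ^ α * v θ) t - D * r θ h t ^ α * v θ * F 0 t) = ω * h) :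
    ∃ L h₀, PerturbedRadius (n + 1) α ω b D L M C h₀ v v' G F r := by
  obtain ⟨K, hK⟩ := hFb 0 (by omega)
  have hlim : Filter.Tendsto
      (fun h : ℝ => |b| * (C + K) * (D * α * (ω * h / 2) ^ (α - 1) * M)) Filter.atTop (nhds 0) := by
    have h1 : Filter.Tendsto (fun h : ℝ => ω * h / 2) Filter.atTop Filter.atTop :=
      (Filter.tendsto_id.const_mul_atTop hω).atTop_div_const two_pos
    have h2 := (tendsto_rpow_neg_atTop (by linarith : 0 < 1 - α)).comp h1
    simpa [Function.comp_def] using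
      ((h2.const_mul (D * α)).mul_const M).const_mul (|b| * (C + K))
  obtain ⟨h₂, h3, h4, h5⟩ := ((hlim.eventually (ge_mem_nhds (by norm_num : (0 : ℝ) < 1 / 2))).and
    ((Filter.eventually_ge_atTop h₁).and (Filter.eventually_ge_atTop 1))).exists
  refine ⟨C + K, h₂, ?_⟩
  exact {
    α_pos := hα
    α_le := hα2
    ω_pos := hω
    D_pos := hD
    one_le := h5
    hasFDerivAt_K := fun z => by
      have h6 := hasFDerivAt_iterD hG (i := 0) (j := 0) (by omega) z
      have h7 : HasFDerivAt (fun z : ℝ × ℝ => z.1) (ContinuousLinearMap.fst ℝ ℝ ℝ) z :=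
        hasFDerivAt_fst
      have h8 := (hF 0 (by omega) z.2).comp_hasFDerivAt z
        (hasFDerivAt_snd : HasFDerivAt Prod.snd (ContinuousLinearMap.snd ℝ ℝ ℝ) z)
      refine (h6.sub (h7.mul h8)).congr_fderiv ?_
      ext <;> simp
    abs_Kx_le := fun x t =>
      (abs_sub _ _).trans (add_le_add (hGC 1 0 (by omega) x t) (hK t))
    hasDerivAt_v := hv
    abs_v_le := hvM
    small := h3
    mem := fun θ h t hh => hmem θ h t (h4.trans hh.le)
    eq := fun θ h t hh => heq θ h t (h4.trans hh.le)
    contDiff_G := hG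
    abs_iterD_G_le := hGC
    hasDerivAt_F := hF
    continuous_F := hFc
    exists_abs_F_le := hFb
    continuous_v' := hv'c
    abs_v'_le := hv'M }

/-- **Lemma 2.8.** For the θ-average
`[R₁](h,t) = (1/2π_p) ∫₀^{2π_p} R₁(h,t,θ) dθ` there are `δ₁ ∈ (0, 1/10)`,
`C' > 0` and `h₀` such that
`|D_h^i D_t^j [R₁](h,t)| ≤ C' (h^{-i} + h^{-δ₁ - i/q})` for `0 ≤ i+j ≤ 21`, `h ≥ h₀`. -/
theorem average_R1_estimates
    (p q a₁ b₁ d ω C : ℝ) (v v' f : ℝ → ℝ) (G Ghat : ℝ → ℝ → ℝ)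
    (f₁ : ℝ → ℝ → ℝ → ℝ) (R R₁ : ℝ → ℝ → ℝ → ℝ)
    (hp : 2 ≤ p) (hq : q = p / (p - 1))
    (ha₁ : 0 < a₁) (hb₁ : 0 < b₁)
    (hab : a₁ ^ (-(1 : ℝ) / p) + b₁ ^ (-(1 : ℝ) / p) = 2)
    (hd : d = p / a₁) (hω : 0 < ω)
    -- `v`
    (hv : ∀ t, HasDerivAt v (v' t) t)
    (hode : ∀ t, HasDerivAt (fun s => phi p (v' s))
      (-a₁ * phi p (max (v t) 0) + b₁ * phi p (max (-v t) 0)) t)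
    (hv0 : v 0 = (p - 1) ^ (1 / p)) (hv'0 : v' 0 = 0)
    -- `f`, `G`
    (hf : ContDiff ℝ 23 f) (hfper : Function.Periodic f (2 * pip p))
    (hG : ContDiff ℝ 21 (fun z : ℝ × ℝ => G z.1 z.2))
    (hGper : ∀ x t, G x (t + 2 * pip p) = G x t)
    (hC : 0 < C)
    (hGbd : ∀ i j : ℕ, i + j ≤ 21 → ∀ x t : ℝ, |iterD G i j x t| ≤ C)
    -- primitive `Ĝ`
    (hGhatx : ∀ x t : ℝ, HasDerivAt (fun y => Ghat y t) (G x t) x)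
    (hGhatbd : ∀ j : ℕ, j ≤ 21 → ∀ x t : ℝ, |iteratedDeriv j (Ghat x) t| ≤ C)
    -- `f₁`
    (hf₁ : ∀ r θ t : ℝ, f₁ r θ t = ω ^ (p - 1) * G (d ^ (1 / p) * r ^ (1 / p) * v θ) t)
    -- `R`: implicit equation and a priori bound, for large `h`
    (hR : ∃ h₁ : ℝ, ∀ h : ℝ, h₁ ≤ h → ∀ t θ : ℝ,
      R h t θ = ω * f₁ (ω * h - R h t θ) θ t
        - ω ^ p * d ^ (1 / p) * (ω * h - R h t θ) ^ (1 / p) * v θ * f t ∧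
      |R h t θ| ≤ ω * h / 2)
    -- definition of `R₁`
    (hR₁ : ∀ h t θ : ℝ,
      R₁ h t θ = -R h t θ - ω ^ p * d ^ (1 / p) * (ω * h) ^ (1 / p) * v θ * f t) :
    ∃ δ₁ C' h₀ : ℝ, 0 < δ₁ ∧ δ₁ < 1 / 10 ∧ 0 < C' ∧
      ∀ i j : ℕ, i + j ≤ 21 → ∀ t h : ℝ, h₀ ≤ h →
        |iterD (fun h t => (1 / (2 * pip p)) * ∫ θ in (0 : ℝ)..(2 * pip p), R₁ h t θ)
            i j h t|
          ≤ C' * (h ^ (-(i : ℝ)) + h ^ (-δ₁ - (i : ℝ) / q)) := by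
  have hp0 : 0 < p := by linarith
  have hp1 : 0 < p - 1 := by linarith
  have hα : 0 < 1 / p := by positivity
  have hα2 : 1 / p ≤ 1 / 2 := one_div_le_one_div_of_le two_pos hp
  have hqα : 1 - 1 / p = 1 / q := by
    rw [hq]
    field_simp
  have hq1 : 1 ≤ q := by
    rw [hq, le_div_iff₀ hp1]
    linarith
  have hD : 0 < d ^ (1 / p) := Real.rpow_pos_of_pos (by rw [hd]; positivity) _
  have hT : 0 < 2 * pip p := mul_pos two_pos (pip_pos hp)
  obtain ⟨w, u, M, c, E, O⟩ := exists_energyOrbit hp hq ha₁ hb₁ hv hode hv0 hv'0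
  obtain ⟨h₁, hR⟩ := hR
  have hFc : ∀ k, k ≤ 20 + 1 + 1 → Continuous (iteratedDeriv k f) := fun k hk =>
    hf.continuous_iteratedDeriv k (by norm_cast; omega)
  have hωp : ω * ω ^ (p - 1) = ω ^ p := by
    nth_rewrite 1 [← Real.rpow_one ω]
    rw [← Real.rpow_add hω]
    ring_nf
  obtain ⟨L, h₀, S⟩ := exists_perturbedRadius (n := 20) (h₁ := h₁) (b := ω ^ p) (G := G)
    (F := fun k => iteratedDeriv k f) (r := fun θ h t => ω * h - R h t θ) hα hα2 hω hD
    O.hasDerivAt_v O.abs_v_le O.continuous_v' O.abs_v'_le hG hGbd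
    (fun k hk t => by
      rw [iteratedDeriv_succ]
      exact (hf.differentiable_iteratedDeriv k (by norm_cast; omega) t).hasDerivAt)
    hFc (fun k hk => (hfper.iteratedDeriv k).exists_abs_le hT.ne' (hFc k hk))
    (fun θ h t hh => by
      have h2 := abs_le.1 (hR h hh t θ).2
      constructor <;> linarith [h2.1, h2.2])
    (fun θ h t hh => by
      have h2 := (hR h hh t θ).1
      rw [hf₁, ← mul_assoc, hωp] at h2
      simp only [iteratedDeriv_zero]
      linarith)
  obtain ⟨K, hK0, hK⟩ := S.exists_average_bound O (by linarith) hq1 hT.le (1 / (2 * pip p))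
    (N := fun h t => (1 / (2 * pip p)) * ∫ θ in (0 : ℝ)..(2 * pip p), R₁ h t θ)
    (fun h t hh => by
      congr 1
      refine intervalIntegral.integral_congr fun θ _ => ?_
      simp only [S.remainder_eq θ h t hh, hR₁, iteratedDeriv_zero]
      ring)
  refine ⟨1 / p / 10, K + 1, h₀ + 1, by positivity, by linarith, by positivity,
    fun i j hij t h hh => ?_⟩
  have h0 : 0 ≤ h := by linarith [S.nonneg]
  refine (hK i j hij t h (by linarith)).trans ?_
  rw [hqα, mul_one_div]
  exact mul_le_mul_of_nonneg_right (by linarith)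
    (add_nonneg (Real.rpow_nonneg h0 _) (Real.rpow_nonneg h0 _))
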